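/- arXiv:2511.19116 — 8 statements merged into one kernel-verified Lean document; each statement's English description precedes it below -/
import Mathlib

section
/- Let p ≥ 1 be a real number and let ρ be a Borel probability measure on ℝ^d with finite p-th moment. Then the regularized weighted mean satisfies |M(ρ) − m_f^h[ρ]|^p ≤ Λ_α · V_p(ρ), i.e. the p-th power of the deviation of the regularized weighted mean from the ordinary mean is bounded by Λ_α times the centered p-th moment of ρ. -/
open MeasureTheory Real

noncomputable section

/-- The regularized Gibbs weight `ψ_h(x) = exp(-α f(x)) + h(α)`. -/
def psiWeight {d : ℕ} (α hα : ℝ) (f : EuclideanSpace ℝ (Fin d) → ℝ)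
    (x : EuclideanSpace ℝ (Fin d)) : ℝ :=
  Real.exp (-α * f x) + hα

/-- The constant `Λ_α = (exp(-α f̲) + h(α)) / h(α)`. -/
def Lam (α hα fbar : ℝ) : ℝ :=
  (Real.exp (-α * fbar) + hα) / hα

/-- The mean `M(ρ) = ∫ x ρ(dx)`. -/
def meanMeas {d : ℕ} (ρ : Measure (EuclideanSpace ℝ (Fin d))) : EuclideanSpace ℝ (Fin d) :=
  ∫ x, x ∂ρ

/-- The regularized weighted mean `m_f^h[ρ] = (∫ x ψ_h(x) ρ(dx)) / (∫ ψ_h(x) ρ(dx))`. -/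
def wMean {d : ℕ} (α hα : ℝ) (f : EuclideanSpace ℝ (Fin d) → ℝ)
    (ρ : Measure (EuclideanSpace ℝ (Fin d))) : EuclideanSpace ℝ (Fin d) :=
  (∫ x, psiWeight α hα f x ∂ρ)⁻¹ • ∫ x, psiWeight α hα f x • x ∂ρ

theorem psiWeight_bounds {d : ℕ} {α hα : ℝ} (hα0 : 0 < α)
    {f : EuclideanSpace ℝ (Fin d) → ℝ} {fbar : ℝ} (hfbar : fbar ∈ lowerBounds (Set.range f))
    (x : EuclideanSpace ℝ (Fin d)) :
    hα ≤ psiWeight α hα f x ∧ psiWeight α hα f x ≤ Real.exp (-α * fbar) + hα := by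
  have hx : fbar ≤ f x := hfbar (Set.mem_range_self x)
  have he : Real.exp (-α * f x) ≤ Real.exp (-α * fbar) := Real.exp_le_exp.2 (by nlinarith)
  have hpos := Real.exp_pos (-α * f x)
  unfold psiWeight
  constructor <;> linarith

/-- Jensen's inequality for the power `p` and an unnormalized weight `w`, in the form of a bound
on any `a` below the weighted average of `g`. -/
theorem rpow_mul_integral_le_of_mul_integral_le {Ω : Type*} [MeasurableSpace Ω] {μ : Measure Ω}
    {w g : Ω → ℝ} {p a : ℝ} (hp : 1 ≤ p) (ha : 0 ≤ a) (hw : ∀ x, 0 ≤ w x) (hg : ∀ x, 0 ≤ g x)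
    (hwi : Integrable w μ) (hwg : Integrable (fun x => w x * g x) μ)
    (hwgp : Integrable (fun x => w x * g x ^ p) μ)
    (h : a * ∫ x, w x ∂μ ≤ ∫ x, w x * g x ∂μ) :
    a ^ p * ∫ x, w x ∂μ ≤ ∫ x, w x * g x ^ p ∂μ := by
  rcases ha.eq_or_lt with rfl | ha
  · rw [Real.zero_rpow (by linarith), zero_mul]
    exact integral_nonneg fun x => mul_nonneg (hw x) (Real.rpow_nonneg (hg x) p)
  have hap : 0 < a ^ p := Real.rpow_pos_of_pos ha p
  have tangent (x : Ω) :
      a ^ p * (1 - p) * w x + a ^ p * p / a * (w x * g x) ≤ w x * g x ^ p := by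
    have hga : 0 ≤ g x / a := div_nonneg (hg x) ha.le
    have hb := one_add_mul_self_le_rpow_one_add (s := g x / a - 1) (by linarith) hp
    rw [add_sub_cancel, Real.div_rpow (hg x) ha.le, le_div_iff₀ hap] at hb
    calc _ = w x * ((1 + p * (g x / a - 1)) * a ^ p) := by ring
      _ ≤ _ := mul_le_mul_of_nonneg_left hb (hw x)
  have hint := integral_mono ((hwi.const_mul (a ^ p * (1 - p))).add
    (hwg.const_mul (a ^ p * p / a))) hwgp tangent
  simp only [Pi.add_apply] at hint
  rw [integral_add (hwi.const_mul _) (hwg.const_mul _), integral_const_mul,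
    integral_const_mul] at hint
  have hc : 0 ≤ a ^ p * p / a := by positivity
  calc a ^ p * ∫ x, w x ∂μ
      = a ^ p * (1 - p) * ∫ x, w x ∂μ + a ^ p * p / a * (a * ∫ x, w x ∂μ) := by
        field_simp; ring
    _ ≤ _ := by gcongr
    _ ≤ _ := hint

/-- `|M(ρ) − m_f^h[ρ]|^p ≤ Λ_α · V_p(ρ)`. -/
theorem statement0 {d : ℕ} (α hα : ℝ) (hα0 : 0 < α) (hh0 : 0 < hα)
    (f : EuclideanSpace ℝ (Fin d) → ℝ) (hf : Measurable f)
    (fbar : ℝ) (hfbar : IsGLB (Set.range f) fbar)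
    (p : ℝ) (hp : 1 ≤ p)
    (ρ : Measure (EuclideanSpace ℝ (Fin d))) [IsProbabilityMeasure ρ]
    (hmom : Integrable (fun x => ‖x‖ ^ p) ρ) :
    ‖meanMeas ρ - wMean α hα f ρ‖ ^ p ≤ Lam α hα fbar * ∫ x, ‖x - meanMeas ρ‖ ^ p ∂ρ := by
  set ψ := psiWeight α hα f
  set M := meanMeas ρ
  set C := Real.exp (-α * fbar) + hα
  have hψb (x) : hα ≤ ψ x ∧ ψ x ≤ C := psiWeight_bounds hα0 hfbar.1 x
  have hψ0 (x) : 0 ≤ ψ x := hh0.le.trans (hψb x).1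
  have hψm : AEStronglyMeasurable ψ ρ :=
    ((measurable_const.mul hf).exp.add_const hα).aestronglyMeasurable
  have hψC : ∀ᵐ x ∂ρ, ‖ψ x‖ ≤ C :=
    .of_forall fun x => (Real.norm_of_nonneg (hψ0 x)).trans_le (hψb x).2
  have hψi : Integrable ψ ρ := .of_bound hψm C hψC
  have hp0 : 0 < p := by linarith
  have hpE : ENNReal.ofReal p ≠ 0 := by simpa using hp0
  have hLp : MemLp (fun x : EuclideanSpace ℝ (Fin d) => x) (ENNReal.ofReal p) ρ := by
    refine (integrable_norm_rpow_iff measurable_id.aestronglyMeasurable hpE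
      ENNReal.ofReal_ne_top).1 ?_
    rwa [ENNReal.toReal_ofReal hp0.le]
  have hid : Integrable (fun x : EuclideanSpace ℝ (Fin d) => x) ρ :=
    hLp.integrable (ENNReal.one_le_ofReal.2 hp)
  have hVp : Integrable (fun x => ‖x - M‖ ^ p) ρ := by
    have := (hLp.sub (memLp_const M)).integrable_norm_rpow hpE ENNReal.ofReal_ne_top
    rwa [ENNReal.toReal_ofReal hp0.le] at this
  have hψg : Integrable (fun x => ψ x * ‖x - M‖) ρ :=
    (hid.sub (integrable_const M)).norm.bdd_mul hψm hψC
  have hψgp : Integrable (fun x => ψ x * ‖x - M‖ ^ p) ρ := hVp.bdd_mul hψm hψC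
  have hψx : Integrable (fun x => ψ x • x) ρ := hid.bdd_smul C hψm hψC
  have hZ : hα ≤ ∫ x, ψ x ∂ρ := by
    simpa using integral_mono (integrable_const hα) hψi fun x => (hψb x).1
  have hZ0 : 0 < ∫ x, ψ x ∂ρ := hh0.trans_le hZ
  have hdev : ‖M - wMean α hα f ρ‖ * ∫ x, ψ x ∂ρ ≤ ∫ x, ψ x * ‖x - M‖ ∂ρ := by
    have hcenter : (∫ x, ψ x ∂ρ) • (wMean α hα f ρ - M) = ∫ x, ψ x • (x - M) ∂ρ := by
      simp only [smul_sub]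
      rw [integral_sub hψx (hψi.smul_const M), integral_smul_const, wMean,
        smul_inv_smul₀ hZ0.ne']
    calc _ = ‖(∫ x, ψ x ∂ρ) • (wMean α hα f ρ - M)‖ := by
          rw [norm_smul, Real.norm_of_nonneg hZ0.le, norm_sub_rev, mul_comm]
      _ ≤ ∫ x, ‖ψ x • (x - M)‖ ∂ρ := hcenter ▸ norm_integral_le_integral_norm _
      _ = _ := by simp only [norm_smul, Real.norm_of_nonneg (hψ0 _)]
  have hjensen := rpow_mul_integral_le_of_mul_integral_le hp (norm_nonneg _) hψ0
    (fun x => norm_nonneg (x - M)) hψi hψg hψgp hdev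
  have hupper : ∫ x, ψ x * ‖x - M‖ ^ p ∂ρ ≤ C * ∫ x, ‖x - M‖ ^ p ∂ρ := by
    rw [← integral_const_mul]
    exact integral_mono hψgp (hVp.const_mul C) fun x =>
      mul_le_mul_of_nonneg_right (hψb x).2 (by positivity)
  rw [Lam, div_mul_eq_mul_div, le_div_iff₀ hh0]
  calc _ ≤ ‖M - wMean α hα f ρ‖ ^ p * ∫ x, ψ x ∂ρ := by gcongr
    _ ≤ _ := hjensen.trans hupper

end
end

section
/- Let p ≥ 1 be real, N ≥ 1, and x_1, …, x_N ∈ ℝ^d with regularized weighted mean m^h. Then for every index 1 ≤ i ≤ N, |x_i − m^h|^p ≤ (Λ_α/N) Σ_{k=1}^N |x_i − x_k|^p ≤ Λ_α · max_{1≤j,k≤N} |x_j − x_k|^p. -/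
open MeasureTheory Real Finset

noncomputable section

/-- The regularized weighted mean of finitely many points,
`m^h = (Σ_k x_k ψ_h(x_k)) / (Σ_k ψ_h(x_k))`. -/
def wMeanPts {d : ℕ} (α hα : ℝ) (f : EuclideanSpace ℝ (Fin d) → ℝ) {N : ℕ}
    (x : Fin N → EuclideanSpace ℝ (Fin d)) : EuclideanSpace ℝ (Fin d) :=
  (∑ k, psiWeight α hα f (x k))⁻¹ • ∑ k, psiWeight α hα f (x k) • x k

/-- A normalized weighted mean is as close to a point, in `p`-th power of the norm, as the
points are on weighted average. -/
lemma norm_sub_weightedMean_rpow_le {ι E : Type*} [Fintype ι] [NormedAddCommGroup E]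
    [NormedSpace ℝ E] {p : ℝ} (hp : 1 ≤ p) (w : ι → ℝ) (hw : ∀ k, 0 ≤ w k)
    (hs : 0 < ∑ k, w k) (x : ι → E) (y : E) :
    ‖y - (∑ k, w k)⁻¹ • ∑ k, w k • x k‖ ^ p ≤
      ∑ k, w k / (∑ j, w j) * ‖y - x k‖ ^ p := by
  have hv : ∀ k, 0 ≤ w k / ∑ j, w j := fun k => div_nonneg (hw k) hs.le
  have hv1 : ∑ k, w k / (∑ j, w j) = 1 := by
    rw [← Finset.sum_div, div_self hs.ne']
  have heq : y - (∑ k, w k)⁻¹ • ∑ k, w k • x k = ∑ k, (w k / ∑ j, w j) • (y - x k) := by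
    simp_rw [smul_sub, Finset.sum_sub_distrib, ← Finset.sum_smul, hv1, one_smul,
      Finset.smul_sum, smul_smul, div_eq_inv_mul]
  calc ‖y - (∑ k, w k)⁻¹ • ∑ k, w k • x k‖ ^ p
      ≤ (∑ k, w k / (∑ j, w j) * ‖y - x k‖) ^ p := by
        refine Real.rpow_le_rpow (norm_nonneg _) ?_ (by linarith)
        rw [heq]
        refine (norm_sum_le _ _).trans_eq (Finset.sum_congr rfl fun k _ => ?_)
        rw [norm_smul, Real.norm_of_nonneg (hv k)]
    _ ≤ ∑ k, w k / (∑ j, w j) * ‖y - x k‖ ^ p :=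
        Real.rpow_arith_mean_le_arith_mean_rpow _ _ _ (fun k _ => hv k) hv1
          (fun k _ => norm_nonneg _) hp

/-- for every `1 ≤ i ≤ N`,
`|x_i − m^h|^p ≤ (Λ_α/N) Σ_k |x_i − x_k|^p ≤ Λ_α · max_{j,k} |x_j − x_k|^p`. -/
theorem statement1 {d : ℕ} (α hα : ℝ) (hα0 : 0 < α) (hh0 : 0 < hα)
    (f : EuclideanSpace ℝ (Fin d) → ℝ) (fbar : ℝ) (hfbar : IsGLB (Set.range f) fbar)
    (p : ℝ) (hp : 1 ≤ p) (N : ℕ) (hN : 1 ≤ N)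
    (x : Fin N → EuclideanSpace ℝ (Fin d)) (i : Fin N) :
    ‖x i - wMeanPts α hα f x‖ ^ p ≤
      Lam α hα fbar / N * ∑ k, ‖x i - x k‖ ^ p ∧
    Lam α hα fbar / N * ∑ k, ‖x i - x k‖ ^ p ≤
      Lam α hα fbar *
        (Finset.univ : Finset (Fin N × Fin N)).sup'
          ⟨(i, i), Finset.mem_univ _⟩ (fun jk => ‖x jk.1 - x jk.2‖ ^ p) := by
  have hNpos : (0 : ℝ) < N := by exact_mod_cast hN
  have hLam : 0 ≤ Lam α hα fbar := by unfold Lam; positivity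
  have hlow : ∀ k, hα ≤ psiWeight α hα f (x k) := fun k =>
    le_add_of_nonneg_left (Real.exp_pos _).le
  have hup : ∀ k, psiWeight α hα f (x k) ≤ Real.exp (-α * fbar) + hα := fun k => by
    have hf : fbar ≤ f (x k) := hfbar.1 ⟨x k, rfl⟩
    exact add_le_add_left (Real.exp_le_exp.2 (by nlinarith)) _
  have hsum : N * hα ≤ ∑ k, psiWeight α hα f (x k) := by
    simpa using Finset.card_nsmul_le_sum Finset.univ _ hα fun k _ => hlow k
  have hpos : 0 < N * hα := by positivity
  constructor
  · refine (norm_sub_weightedMean_rpow_le hp (fun k => psiWeight α hα f (x k))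
      (fun k => hh0.le.trans (hlow k)) (hpos.trans_le hsum) x (x i)).trans ?_
    rw [Finset.mul_sum]
    refine Finset.sum_le_sum fun k _ => mul_le_mul_of_nonneg_right ?_ (by positivity)
    calc psiWeight α hα f (x k) / ∑ j, psiWeight α hα f (x j)
        ≤ (Real.exp (-α * fbar) + hα) / (N * hα) :=
          div_le_div₀ (by positivity) (hup k) hpos hsum
      _ = Lam α hα fbar / N := by rw [Lam, div_div, mul_comm hα]
  · rw [div_mul_eq_mul_div, mul_div_assoc]
    refine mul_le_mul_of_nonneg_left ?_ hLam
    rw [div_le_iff₀' hNpos]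
    simpa using Finset.sum_le_card_nsmul Finset.univ (fun k => ‖x i - x k‖ ^ p) _ fun k _ =>
      Finset.le_sup' (fun jk : Fin N × Fin N => ‖x jk.1 - x jk.2‖ ^ p)
        (Finset.mem_univ (i, k))

end
end

section
/- Let ρ be a Borel probability measure on ℝ^d with finite second moment. Then ∫_{ℝ^d} |x − m_f^h[ρ]|² ρ(dx) ≤ 2 Λ_α ∫_{ℝ^d} |x − M(ρ)|² ρ(dx), i.e. the second moment of ρ about its regularized weighted mean is at most 2Λ_α times its variance. -/
open MeasureTheory Real

noncomputable section

section WeightedMean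

variable {E : Type*} [NormedAddCommGroup E] [InnerProductSpace ℝ E]

lemma weight_mul_norm_sub_sq (w : E → ℝ) (c x : E) :
    w x * ‖x - c‖ ^ 2 = w x * ‖x‖ ^ 2 - 2 * inner ℝ c (w x • x) + ‖c‖ ^ 2 * w x := by
  rw [norm_sub_sq_real, real_inner_smul_right, real_inner_comm]
  ring

variable [MeasurableSpace E] {μ : Measure E} {w : E → ℝ}

lemma integrable_weight_mul_norm_sub_sq (hw : Integrable w μ)
    (hw1 : Integrable (fun x => w x • x) μ) (hw2 : Integrable (fun x => w x * ‖x‖ ^ 2) μ) (c : E) :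
    Integrable (fun x => w x * ‖x - c‖ ^ 2) μ := by
  simp_rw [weight_mul_norm_sub_sq w c]
  exact (hw2.sub ((hw1.const_inner c).const_mul 2)).add (hw.const_mul _)

lemma integral_weight_mul_norm_sub_sq [CompleteSpace E] (hw : Integrable w μ)
    (hw1 : Integrable (fun x => w x • x) μ) (hw2 : Integrable (fun x => w x * ‖x‖ ^ 2) μ) (c : E) :
    ∫ x, w x * ‖x - c‖ ^ 2 ∂μ = ∫ x, w x * ‖x‖ ^ 2 ∂μ
      - 2 * inner ℝ c (∫ x, w x • x ∂μ) + ‖c‖ ^ 2 * ∫ x, w x ∂μ := by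
  have hi : Integrable (fun x => 2 * inner ℝ c (w x • x)) μ := (hw1.const_inner c).const_mul 2
  simp_rw [weight_mul_norm_sub_sq w c]
  rw [integral_add (f := fun x => w x * ‖x‖ ^ 2 - 2 * inner ℝ c (w x • x)) (hw2.sub hi)
    (hw.const_mul _), integral_sub hw2 hi, integral_const_mul, integral_const_mul,
    integral_inner hw1]

/-- The parallel axis identity about the `w`-weighted mean `m` of `μ`. -/
lemma integral_weight_mul_norm_sub_sq_eq_add [CompleteSpace E] (hw : Integrable w μ)
    (hw1 : Integrable (fun x => w x • x) μ) (hw2 : Integrable (fun x => w x * ‖x‖ ^ 2) μ)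
    {m : E} (hm : ∫ x, w x • x ∂μ = (∫ x, w x ∂μ) • m) (c : E) :
    ∫ x, w x * ‖x - c‖ ^ 2 ∂μ =
      ∫ x, w x * ‖x - m‖ ^ 2 ∂μ + (∫ x, w x ∂μ) * ‖m - c‖ ^ 2 := by
  rw [integral_weight_mul_norm_sub_sq hw hw1 hw2, integral_weight_mul_norm_sub_sq hw hw1 hw2, hm,
    real_inner_smul_right, real_inner_smul_right, real_inner_self_eq_norm_sq, norm_sub_sq_real,
    real_inner_comm]
  ring

/-- If `a ≤ w ≤ b` with `0 < a`, the second moment about the `w`-weighted mean is at most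
`1 + b / a` times the variance. -/
lemma integral_norm_sub_weightedMean_sq_le [CompleteSpace E] [BorelSpace E]
    [SecondCountableTopology E] [IsProbabilityMeasure μ] (hμ : Integrable (fun x => ‖x‖ ^ 2) μ)
    (hwm : Measurable w) {a b : ℝ} (ha : 0 < a) (haw : ∀ x, a ≤ w x) (hwb : ∀ x, w x ≤ b) :
    ∫ x, ‖x - (∫ y, w y ∂μ)⁻¹ • ∫ y, w y • y ∂μ‖ ^ 2 ∂μ ≤
      (1 + b / a) * ∫ x, ‖x - ∫ y, y ∂μ‖ ^ 2 ∂μ := by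
  have hid : Integrable (fun x : E => x) μ :=
    ((memLp_two_iff_integrable_sq_norm aestronglyMeasurable_id).2 hμ).integrable one_le_two
  have hbd : ∀ᵐ x ∂μ, ‖w x‖ ≤ b := .of_forall fun x => by
    rw [Real.norm_of_nonneg (ha.le.trans (haw x))]
    exact hwb x
  have hws : AEStronglyMeasurable w μ := hwm.aestronglyMeasurable
  have hw : Integrable w μ := .of_bound hws b hbd
  have hw1 : Integrable (fun x => w x • x) μ := hid.bdd_smul b hws hbd
  have hw2 : Integrable (fun x => w x * ‖x‖ ^ 2) μ := hμ.bdd_mul hws hbd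
  have haZ : a ≤ ∫ y, w y ∂μ := by
    simpa using integral_mono (integrable_const a) hw haw
  set Z := ∫ y, w y ∂μ
  set m := Z⁻¹ • ∫ y, w y • y ∂μ with hm
  set M := ∫ y, y ∂μ with hM
  set V := ∫ x, ‖x - M‖ ^ 2 ∂μ with hV
  have hvar : ∫ x, ‖x - m‖ ^ 2 ∂μ = V + ‖M - m‖ ^ 2 := by
    simpa [hV] using integral_weight_mul_norm_sub_sq_eq_add (μ := μ) (integrable_const (1 : ℝ))
      (by simpa using hid) (by simpa using hμ) (m := M) (by simp [hM]) m
  have hwvar := integral_weight_mul_norm_sub_sq_eq_add hw hw1 hw2 (m := m)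
    (by rw [hm, smul_inv_smul₀ (ha.trans_le haZ).ne']) M
  have hVint : Integrable (fun x => ‖x - M‖ ^ 2) μ := by
    simpa using integrable_weight_mul_norm_sub_sq (w := fun _ => 1) (integrable_const _)
      (by simpa using hid) (by simpa using hμ) M
  have hle : ∫ x, w x * ‖x - M‖ ^ 2 ∂μ ≤ b * V := by
    rw [hV, ← integral_const_mul]
    exact integral_mono (integrable_weight_mul_norm_sub_sq hw hw1 hw2 M) (hVint.const_mul b)
      fun x => mul_le_mul_of_nonneg_right (hwb x) (sq_nonneg _)
  have hnonneg : 0 ≤ ∫ x, w x * ‖x - m‖ ^ 2 ∂μ :=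
    integral_nonneg fun x => mul_nonneg (ha.le.trans (haw x)) (sq_nonneg _)
  have hdist : ‖M - m‖ ^ 2 ≤ b / a * V := by
    rw [div_mul_eq_mul_div, le_div_iff₀ ha, norm_sub_rev]
    nlinarith [mul_le_mul_of_nonneg_right haZ (sq_nonneg ‖m - M‖)]
  rw [hvar]
  linarith

end WeightedMean

/-- `∫ |x − m_f^h[ρ]|² ρ(dx) ≤ 2Λ_α ∫ |x − M(ρ)|² ρ(dx)`. -/
theorem statement2 {d : ℕ} (α hα : ℝ) (hα0 : 0 < α) (hh0 : 0 < hα)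
    (f : EuclideanSpace ℝ (Fin d) → ℝ) (hf : Measurable f)
    (fbar : ℝ) (hfbar : IsGLB (Set.range f) fbar)
    (ρ : Measure (EuclideanSpace ℝ (Fin d))) [IsProbabilityMeasure ρ]
    (hmom : Integrable (fun x => ‖x‖ ^ 2) ρ) :
    ∫ x, ‖x - wMean α hα f ρ‖ ^ 2 ∂ρ ≤
      2 * Lam α hα fbar * ∫ x, ‖x - meanMeas ρ‖ ^ 2 ∂ρ := by
  have hmeas : Measurable (psiWeight α hα f) := ((hf.const_mul (-α)).exp).add_const hα
  have hge : ∀ x, hα ≤ psiWeight α hα f x := fun x =>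
    le_add_of_nonneg_left (Real.exp_pos _).le
  have hle : ∀ x, psiWeight α hα f x ≤ Real.exp (-α * fbar) + hα := fun x => by
    have hfx : fbar ≤ f x := hfbar.1 ⟨x, rfl⟩
    unfold psiWeight
    gcongr ?_ + _
    exact Real.exp_le_exp.2 (mul_le_mul_of_nonpos_left hfx (neg_nonpos.2 hα0.le))
  have hLam : 1 ≤ Lam α hα fbar :=
    (one_le_div hh0).2 (le_add_of_nonneg_left (Real.exp_pos _).le)
  calc ∫ x, ‖x - wMean α hα f ρ‖ ^ 2 ∂ρ
      ≤ (1 + Lam α hα fbar) * ∫ x, ‖x - meanMeas ρ‖ ^ 2 ∂ρ :=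
        integral_norm_sub_weightedMean_sq_le hmom hmeas hh0 hge hle
    _ ≤ 2 * Lam α hα fbar * ∫ x, ‖x - meanMeas ρ‖ ^ 2 ∂ρ := by
        gcongr
        linarith

end
end

section
/- (Stability of the regularized weighted mean, Lemma 3.1.) Let p ≥ 2 and assume that the Gibbs weight ω_f^α is Lipschitz continuous with Lipschitz constant L_{ω_f^α}. Then for all Borel probability measures μ, ν on ℝ^d with finite p-th moments, |m_f^h[μ] − M(μ) − m_f^h[ν] + M(ν)| ≤ (L_{ω_f^α} Λ_α / h(α)) · (V_p(μ)^{1/p} + V_p(ν)^{1/p}) · W_p(μ, ν). -/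
open MeasureTheory Real

noncomputable section

/-- The set of couplings of two measures: probability measures on the product space
whose marginals are `μ` and `ν`. -/
def couplings {d : ℕ} (μ ν : Measure (EuclideanSpace ℝ (Fin d))) :
    Set (Measure (EuclideanSpace ℝ (Fin d) × EuclideanSpace ℝ (Fin d))) :=
  {γ | γ.map Prod.fst = μ ∧ γ.map Prod.snd = ν}

/-- The `p`-Wasserstein distance
`W_p(μ, ν) = inf_π (∬ |x − y|^p π(dx,dy))^{1/p}`. -/
def Wass {d : ℕ} (p : ℝ) (μ ν : Measure (EuclideanSpace ℝ (Fin d))) : ℝ :=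
  ((⨅ γ ∈ couplings μ ν, ∫⁻ z, ENNReal.ofReal (‖z.1 - z.2‖ ^ p) ∂γ) ^ (1 / p)).toReal

theorem norm_integral_smul_le_lpNorm_mul_lpNorm {Ω E : Type*} [MeasurableSpace Ω]
    [NormedAddCommGroup E] [NormedSpace ℝ E] {γ : Measure Ω} {c : Ω → ℝ} {w : Ω → E}
    (hc : MemLp c 2 γ) (hw : MemLp w 2 γ) :
    ‖∫ z, c z • w z ∂γ‖ ≤ lpNorm c 2 γ * lpNorm w 2 γ := by
  have h := integral_mul_norm_le_Lp_mul_Lq (μ := γ) (f := c) (g := fun z => ‖w z‖)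
    Real.HolderConjugate.two_two (by simpa using hc) (by simpa using hw.norm)
  rw [lpNorm_eq_integral_norm_rpow_toReal (by simp) (by simp) hc.1,
    lpNorm_eq_integral_norm_rpow_toReal (by simp) (by simp) hw.1]
  refine (norm_integral_le_integral_norm _).trans ?_
  simpa [norm_smul] using h

theorem lpNorm_sub_integral_le_lpNorm_sub_const {Ω : Type*} [MeasurableSpace Ω]
    {γ : Measure Ω} [IsProbabilityMeasure γ] {X : Ω → ℝ} (hX : MemLp X 2 γ) (c : ℝ) :
    lpNorm (fun z => X z - ∫ y, X y ∂γ) 2 γ ≤ lpNorm (fun z => X z - c) 2 γ := by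
  have hc : ∀ b : ℝ, AEStronglyMeasurable (fun z => X z - b) γ :=
    fun b => hX.1.sub aestronglyMeasurable_const
  rw [lpNorm_eq_integral_norm_rpow_toReal (by simp) (by simp) (hc _),
    lpNorm_eq_integral_norm_rpow_toReal (by simp) (by simp) (hc _)]
  have h := ProbabilityTheory.variance_le_expectation_sq (hc c)
  rw [ProbabilityTheory.variance_sub_const hX.1,
    ProbabilityTheory.variance_eq_integral hX.1.aemeasurable] at h
  simp only [ENNReal.toReal_ofNat, Real.rpow_ofNat, Real.norm_eq_abs, sq_abs]
  exact Real.rpow_le_rpow (integral_nonneg fun _ => sq_nonneg _) h (by norm_num)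

theorem lpNorm_le_lpNorm_of_exponent_le {Ω E : Type*} [MeasurableSpace Ω]
    [NormedAddCommGroup E] {γ : Measure Ω} [IsProbabilityMeasure γ] {q r : ENNReal} {X : Ω → E}
    (hqr : q ≤ r) (hX : MemLp X r γ) : lpNorm X q γ ≤ lpNorm X r γ := by
  rw [← toReal_eLpNorm hX.1, ← toReal_eLpNorm hX.1]
  exact ENNReal.toReal_mono hX.2.ne (eLpNorm_le_eLpNorm_of_exponent_le hqr hX.1)

theorem lpNorm_le_mul_lpNorm {Ω E F : Type*} [MeasurableSpace Ω]
    [NormedAddCommGroup E] [NormedSpace ℝ E] [NormedAddCommGroup F] {γ : Measure Ω}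
    {q : ENNReal} {X : Ω → E} {Y : Ω → F} {C : ℝ} (hC : 0 ≤ C) (hX : MemLp X q γ)
    (h : ∀ z, ‖Y z‖ ≤ C * ‖X z‖) : lpNorm Y q γ ≤ C * lpNorm X q γ := by
  have h1 := lpNorm_mono_real (μ := γ) (p := q) (f := Y) (g := fun z => ‖(C • X) z‖)
    (hX.const_smul C).norm (fun z => by simpa [norm_smul, abs_of_nonneg hC] using h z)
  refine h1.trans ?_
  rw [lpNorm_norm (hX.const_smul C).1, lpNorm_const_smul]
  simp [abs_of_nonneg hC]

/-- Stability of the weighted mean with weight `g + h`, along a pair of random variables. -/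
theorem norm_weighted_mean_sub_le {Ω E : Type*} [MeasurableSpace Ω]
    [NormedAddCommGroup E] [NormedSpace ℝ E] [CompleteSpace E]
    {γ : Measure Ω} [IsProbabilityMeasure γ]
    {g : E → ℝ} {L : NNReal} {K h : ℝ} (hg : LipschitzWith L g) (hg0 : ∀ x, 0 ≤ g x)
    (hgK : ∀ x, g x ≤ K) (hh : 0 < h) {X Y : Ω → E} (hX : MemLp X 2 γ) (hY : MemLp Y 2 γ)
    {a b : E} (ha : ∫ z, X z ∂γ = a) (hb : ∫ z, Y z ∂γ = b) :
    ‖(∫ z, (g (X z) + h) ∂γ)⁻¹ • ∫ z, (g (X z) + h) • X z ∂γ - a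
        - (∫ z, (g (Y z) + h) ∂γ)⁻¹ • ∫ z, (g (Y z) + h) • Y z ∂γ + b‖ ≤
      (L * ((K + h) / h) / h) *
        (lpNorm (fun z => X z - a) 2 γ + lpNorm (fun z => Y z - b) 2 γ) *
        lpNorm (fun z => X z - Y z) 2 γ := by
  have hK : 0 ≤ K := (hg0 0).trans (hgK 0)
  have gmem : ∀ {U : Ω → E} {q : ENNReal}, MemLp U 2 γ → MemLp (fun z => g (U z)) q γ := by
    intro U q hU
    refine MemLp.of_bound (hg.continuous.comp_aestronglyMeasurable hU.1) K (.of_forall fun z => ?_)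
    rw [Real.norm_eq_abs, abs_of_nonneg (hg0 _)]
    exact hgK _
  have smulint : ∀ {c : Ω → ℝ} {w : Ω → E}, MemLp c 2 γ → MemLp w 2 γ →
      Integrable (fun z => c z • w z) γ := fun hc hw =>
    memLp_one_iff_integrable.1 (hw.smul hc)
  have hu : MemLp (fun z => X z - a) 2 γ := hX.sub (memLp_const a)
  have hv : MemLp (fun z => Y z - b) 2 γ := hY.sub (memLp_const b)
  have hw : MemLp (fun z => X z - Y z) 2 γ := hX.sub hY
  have Xint : Integrable X γ := hX.integrable (by norm_num)
  have Yint : Integrable Y γ := hY.integrable (by norm_num)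
  have gint : ∀ {U : Ω → E}, MemLp U 2 γ → Integrable (fun z => g (U z)) γ :=
    fun hU => memLp_one_iff_integrable.1 (gmem hU)
  have hgh : ∀ {U : Ω → E}, MemLp U 2 γ → MemLp (fun z => g (U z) + h) 2 γ :=
    fun hU => (gmem hU).add (memLp_const h)
  have ghint : ∀ {U : Ω → E}, MemLp U 2 γ → Integrable (fun z => g (U z) + h) γ :=
    fun hU => (gint hU).add (integrable_const h)
  have Zle : ∀ {U : Ω → E}, MemLp U 2 γ → h ≤ ∫ z, (g (U z) + h) ∂γ := by
    intro U hU
    rw [integral_add (gint hU) (integrable_const h)]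
    simpa using integral_nonneg (μ := γ) fun z => hg0 (U z)
  have centre : ∀ {U : Ω → E} {m : E}, MemLp U 2 γ →
      (∫ z, (g (U z) + h) ∂γ)⁻¹ • ∫ z, (g (U z) + h) • U z ∂γ - m =
        (∫ z, (g (U z) + h) ∂γ)⁻¹ • ∫ z, (g (U z) + h) • (U z - m) ∂γ := by
    intro U m hU
    have hZ := (hh.trans_le (Zle hU)).ne'
    simp_rw [smul_sub]
    rw [integral_sub (smulint (hgh hU) hU)
      ((ghint hU).smul_const m), integral_smul_const, smul_sub,
      inv_smul_smul₀ hZ]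
  set Z₁ := ∫ z, (g (X z) + h) ∂γ with hZ₁
  set Z₂ := ∫ z, (g (Y z) + h) ∂γ with hZ₂
  set A := ∫ z, (g (X z) + h) • (X z - a) ∂γ with hA
  set B := ∫ z, (g (Y z) + h) • (Y z - b) ∂γ with hB
  set u := lpNorm (fun z => X z - a) 2 γ
  set v := lpNorm (fun z => Y z - b) 2 γ
  set w := lpNorm (fun z => X z - Y z) 2 γ
  have hu0 : 0 ≤ u := lpNorm_nonneg
  have hv0 : 0 ≤ v := lpNorm_nonneg
  have hw0 : 0 ≤ w := lpNorm_nonneg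
  have Z1 : h ≤ Z₁ := Zle hX
  have Z2 : h ≤ Z₂ := Zle hY
  have hgd : MemLp (fun z => g (X z) - g (Y z)) 2 γ := (gmem hX).sub (gmem hY)
  have lipd : lpNorm (fun z => g (X z) - g (Y z)) 2 γ ≤ L * w :=
    lpNorm_le_mul_lpNorm L.2 hw fun z => hg.norm_sub_le _ _
  have lipY : lpNorm (fun z => g (Y z) - ∫ y, g (Y y) ∂γ) 2 γ ≤ L * v :=
    (lpNorm_sub_integral_le_lpNorm_sub_const (gmem hY) (g b)).trans <|
      lpNorm_le_mul_lpNorm L.2 hv fun z => hg.norm_sub_le _ _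
  have hw' : MemLp (fun z => X z - Y z - (a - b)) 2 γ := hw.sub (memLp_const _)
  have wint : Integrable (fun z => X z - Y z) γ := Xint.sub Yint
  have wsint : ∀ c : ℝ, Integrable (fun z => c • (X z - Y z)) γ := fun c => wint.smul c
  have vsint : Integrable (fun z => h • (Y z - b)) γ := (Yint.sub (integrable_const b)).smul h
  have split : A - B = (∫ z, (g (X z) - g (Y z)) • (X z - a) ∂γ) +
      ∫ z, (g (Y z) - ∫ y, g (Y y) ∂γ) • (X z - Y z) ∂γ := by
    have e1 : A - B = (∫ z, (g (X z) - g (Y z)) • (X z - a) ∂γ) +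
        ∫ z, (g (Y z) + h) • ((X z - Y z) - (a - b)) ∂γ := by
      rw [hA, hB, ← integral_sub (smulint (hgh hX) hu)
        (smulint (hgh hY) hv),
        ← integral_add (smulint hgd hu)
        (smulint (hgh hY) hw')]
      congr 1 with z
      module
    rw [e1]
    congr 1
    have e2 : ∀ z, (g (Y z) + h) • ((X z - Y z) - (a - b)) =
        (g (Y z) • (X z - Y z) + h • (X z - Y z)) - (g (Y z) + h) • (a - b) := fun z => by module
    have e3 : ∫ z, (X z - Y z) ∂γ = a - b := by rw [integral_sub Xint Yint, ha, hb]
    simp_rw [e2, sub_smul (g _)]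
    have hsum : Integrable (fun z => g (Y z) • (X z - Y z) + h • (X z - Y z)) γ :=
      (smulint (gmem hY) hw).add (wsint h)
    rw [integral_sub hsum
        ((ghint hY).smul_const _),
      integral_add (smulint (gmem hY) hw) (wsint h),
      integral_sub (smulint (gmem hY) hw) (wsint _), integral_smul, integral_smul,
      integral_smul_const, integral_add (gint hY) (integrable_const h), e3]
    simp only [integral_const, probReal_univ, one_smul]
    module
  have AB : ‖A - B‖ ≤ L * (u + v) * w := by
    rw [split]
    refine (norm_add_le _ _).trans ?_
    have h1 := (norm_integral_smul_le_lpNorm_mul_lpNorm hgd hu).trans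
      (mul_le_mul_of_nonneg_right lipd hu0)
    have h2 := (norm_integral_smul_le_lpNorm_mul_lpNorm
      ((gmem hY).sub (memLp_const (∫ y, g (Y y) ∂γ))) hw).trans
      (mul_le_mul_of_nonneg_right lipY hw0)
    simp only [Pi.sub_apply] at h2
    linarith
  have Bbd : ‖B‖ ≤ K * v := by
    have e : B = ∫ z, g (Y z) • (Y z - b) ∂γ := by
      rw [hB]
      simp_rw [add_smul]
      rw [integral_add (smulint (gmem hY) hv) vsint,
        integral_smul, integral_sub Yint (integrable_const b), hb]
      simp
    rw [e]
    refine (norm_integral_smul_le_lpNorm_mul_lpNorm (gmem hY) hv).trans ?_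
    gcongr
    refine (lpNorm_mono_real (g := fun _ => K) (memLp_const K) fun z => ?_).trans ?_
    · rw [Real.norm_eq_abs, abs_of_nonneg (hg0 _)]
      exact hgK _
    · rw [lpNorm_const' (by simp) (by simp)]
      simp [abs_of_nonneg hK]
  have Zd : |Z₂ - Z₁| ≤ L * w := by
    have e : Z₂ - Z₁ = -∫ z, (g (X z) - g (Y z)) ∂γ := by
      rw [hZ₁, hZ₂, integral_add (gint hX) (integrable_const h),
        integral_add (gint hY) (integrable_const h), integral_sub (gint hX) (gint hY)]
      ring
    rw [e, abs_neg]
    refine (norm_integral_le_integral_norm (fun z => g (X z) - g (Y z))).trans ?_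
    rw [← lpNorm_one_eq_integral_norm hgd.1]
    exact (lpNorm_le_lpNorm_of_exponent_le (by norm_num) hgd).trans lipd
  have hZ1 : 0 < Z₁ := hh.trans_le Z1
  have hZ2 : 0 < Z₂ := hh.trans_le Z2
  have key : Z₁⁻¹ • A - Z₂⁻¹ • B = Z₁⁻¹ • ((A - B) + (Z₂⁻¹ * (Z₂ - Z₁)) • B) := by
    match_scalars
    all_goals field_simp
    ring
  rw [centre hX, sub_add, ← hA, centre hY, ← hB, key, norm_smul, norm_inv, Real.norm_eq_abs,
    abs_of_pos hZ1]
  have hin : ‖(Z₂⁻¹ * (Z₂ - Z₁)) • B‖ ≤ h⁻¹ * (L * w) * (K * v) := by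
    rw [norm_smul, norm_mul, norm_inv, Real.norm_eq_abs, Real.norm_eq_abs, abs_of_pos hZ2]
    gcongr
  calc Z₁⁻¹ * ‖(A - B) + (Z₂⁻¹ * (Z₂ - Z₁)) • B‖
      ≤ h⁻¹ * (L * (u + v) * w + h⁻¹ * (L * w) * (K * v)) := by
        gcongr
        exact (norm_add_le _ _).trans (add_le_add AB hin)
    _ ≤ h⁻¹ * (L * (u + v) * w + h⁻¹ * (L * w) * (K * (u + v))) := by
        gcongr
        linarith
    _ = _ := by
        field_simp
        ring

theorem memLp_of_integrable_norm_rpow {Ω E : Type*} [MeasurableSpace Ω] [NormedAddCommGroup E]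
    {γ : Measure Ω} {X : Ω → E} (hX : AEStronglyMeasurable X γ) {p : ℝ} (hp : 0 < p)
    (h : Integrable (fun z => ‖X z‖ ^ p) γ) : MemLp X (ENNReal.ofReal p) γ := by
  rw [← integrable_norm_rpow_iff hX (by simpa using hp) (by simp)]
  simpa [ENNReal.toReal_ofReal hp.le] using h

theorem lpNorm_ofReal_eq_integral {Ω E : Type*} [MeasurableSpace Ω] [NormedAddCommGroup E]
    {γ : Measure Ω} {X : Ω → E} (hX : AEStronglyMeasurable X γ) {p : ℝ} (hp : 0 < p) :
    lpNorm X (ENNReal.ofReal p) γ = (∫ z, ‖X z‖ ^ p ∂γ) ^ (1 / p) := by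
  rw [lpNorm_eq_integral_norm_rpow_toReal (by simpa using hp) (by simp) hX,
    ENNReal.toReal_ofReal hp.le, one_div]

theorem memLp_fst_snd_of_mem_couplings {d : ℕ} {p : ℝ} (hp0 : 0 < p)
    {μ ν : Measure (EuclideanSpace ℝ (Fin d))}
    (hmomμ : Integrable (fun x => ‖x‖ ^ p) μ) (hmomν : Integrable (fun x => ‖x‖ ^ p) ν)
    {γ : Measure (EuclideanSpace ℝ (Fin d) × EuclideanSpace ℝ (Fin d))}
    (hγ : γ ∈ couplings μ ν) :
    MemLp (fun z => z.1) (ENNReal.ofReal p) γ ∧ MemLp (fun z => z.2) (ENNReal.ofReal p) γ := by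
  obtain ⟨h1, h2⟩ := hγ
  constructor
  · refine memLp_of_integrable_norm_rpow measurable_fst.aestronglyMeasurable hp0 ?_
    rw [← h1] at hmomμ
    exact hmomμ.comp_measurable measurable_fst
  · refine memLp_of_integrable_norm_rpow measurable_snd.aestronglyMeasurable hp0 ?_
    rw [← h2] at hmomν
    exact hmomν.comp_measurable measurable_snd

theorem norm_wMean_sub_le_of_coupling {d : ℕ} {α hα : ℝ} (hα0 : 0 < α) (hh0 : 0 < hα)
    {f : EuclideanSpace ℝ (Fin d) → ℝ} {fbar : ℝ} (hfbar : IsGLB (Set.range f) fbar)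
    {L : NNReal} (hLip : LipschitzWith L (fun x => Real.exp (-α * f x)))
    {p : ℝ} (hp : 2 ≤ p) {μ ν : Measure (EuclideanSpace ℝ (Fin d))}
    [IsProbabilityMeasure μ]
    (hmomμ : Integrable (fun x => ‖x‖ ^ p) μ) (hmomν : Integrable (fun x => ‖x‖ ^ p) ν)
    {γ : Measure (EuclideanSpace ℝ (Fin d) × EuclideanSpace ℝ (Fin d))}
    (hγ : γ ∈ couplings μ ν) :
    ‖wMean α hα f μ - meanMeas μ - wMean α hα f ν + meanMeas ν‖ ≤
      (L * Lam α hα fbar / hα) *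
        ((∫ x, ‖x - meanMeas μ‖ ^ p ∂μ) ^ (1 / p) +
          (∫ x, ‖x - meanMeas ν‖ ^ p ∂ν) ^ (1 / p)) *
        lpNorm (fun z => z.1 - z.2) (ENNReal.ofReal p) γ := by
  have hp0 : 0 < p := by linarith
  have h2p : (2 : ENNReal) ≤ ENNReal.ofReal p := by
    simpa using ENNReal.ofReal_le_ofReal hp
  obtain ⟨h1, h2⟩ := hγ
  have : IsProbabilityMeasure γ := by
    constructor
    rw [← measure_univ (μ := μ), ← h1, Measure.map_apply measurable_fst .univ, Set.preimage_univ]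
  have i1 : ∀ {F : Type} [NormedAddCommGroup F] [NormedSpace ℝ F]
      {G : EuclideanSpace ℝ (Fin d) → F}, Continuous G → ∫ x, G x ∂μ = ∫ z, G z.1 ∂γ := by
    intro F _ _ G hG
    rw [← h1, integral_map measurable_fst.aemeasurable]
    exact hG.aestronglyMeasurable
  have i2 : ∀ {F : Type} [NormedAddCommGroup F] [NormedSpace ℝ F]
      {G : EuclideanSpace ℝ (Fin d) → F}, Continuous G → ∫ x, G x ∂ν = ∫ z, G z.2 ∂γ := by
    intro F _ _ G hG
    rw [← h2, integral_map measurable_snd.aemeasurable]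
    exact hG.aestronglyMeasurable
  have cψ : Continuous (psiWeight α hα f) := hLip.continuous.add continuous_const
  have cψx : Continuous fun x => psiWeight α hα f x • x := cψ.smul continuous_id
  obtain ⟨mX, mY⟩ := memLp_fst_snd_of_mem_couplings hp0 hmomμ hmomν ⟨h1, h2⟩
  have bound := norm_weighted_mean_sub_le (K := Real.exp (-α * fbar)) hLip
    (fun x => (Real.exp_pos _).le)
    (fun x => Real.exp_le_exp.2 (by nlinarith [hfbar.1 (Set.mem_range_self x)])) hh0
    (mX.mono_exponent h2p) (mY.mono_exponent h2p) (a := meanMeas μ) (b := meanMeas ν)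
    (i1 continuous_id).symm (i2 continuous_id).symm
  have mu : MemLp (fun z => z.1 - meanMeas μ) (ENNReal.ofReal p) γ := mX.sub (memLp_const _)
  have mv : MemLp (fun z => z.2 - meanMeas ν) (ENNReal.ofReal p) γ := mY.sub (memLp_const _)
  have cn : ∀ m : EuclideanSpace ℝ (Fin d), Continuous fun x => ‖x - m‖ ^ p := fun m =>
    (continuous_id.sub continuous_const).norm.rpow_const fun _ => Or.inr hp0.le
  have hΛ : 0 ≤ Lam α hα fbar := by unfold Lam; positivity
  rw [i1 (cn _), i2 (cn _), ← lpNorm_ofReal_eq_integral mu.1 hp0,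
    ← lpNorm_ofReal_eq_integral mv.1 hp0]
  unfold wMean
  rw [i1 cψ, i2 cψ, i1 cψx, i2 cψx]
  refine le_trans bound ?_
  change L * Lam α hα fbar / hα * _ * _ ≤ _
  gcongr
  · exact lpNorm_nonneg
  · exact mul_nonneg (by positivity) (add_nonneg lpNorm_nonneg lpNorm_nonneg)
  · exact lpNorm_le_lpNorm_of_exponent_le h2p mu
  · exact lpNorm_le_lpNorm_of_exponent_le h2p mv
  · exact lpNorm_le_lpNorm_of_exponent_le h2p (mX.sub mY)

/-- stability of the regularized weighted mean:
`|m_f^h[μ] − M(μ) − m_f^h[ν] + M(ν)|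
  ≤ (L Λ_α / h(α)) (V_p(μ)^{1/p} + V_p(ν)^{1/p}) W_p(μ, ν)`. -/
theorem statement3 {d : ℕ} (α hα : ℝ) (hα0 : 0 < α) (hh0 : 0 < hα)
    (f : EuclideanSpace ℝ (Fin d) → ℝ) (hf : Measurable f)
    (fbar : ℝ) (hfbar : IsGLB (Set.range f) fbar)
    (L : NNReal) (hLip : LipschitzWith L (fun x => Real.exp (-α * f x)))
    (p : ℝ) (hp : 2 ≤ p)
    (μ ν : Measure (EuclideanSpace ℝ (Fin d)))
    [IsProbabilityMeasure μ] [IsProbabilityMeasure ν]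
    (hmomμ : Integrable (fun x => ‖x‖ ^ p) μ)
    (hmomν : Integrable (fun x => ‖x‖ ^ p) ν) :
    ‖wMean α hα f μ - meanMeas μ - wMean α hα f ν + meanMeas ν‖ ≤
      (L * Lam α hα fbar / hα) *
        ((∫ x, ‖x - meanMeas μ‖ ^ p ∂μ) ^ (1 / p) +
          (∫ x, ‖x - meanMeas ν‖ ^ p ∂ν) ^ (1 / p)) *
        Wass p μ ν := by
  have hp0 : 0 < p := by linarith
  have hΛ : 0 ≤ Lam α hα fbar := by unfold Lam; positivity
  have hbound := fun γ (hγ : γ ∈ couplings μ ν) =>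
    norm_wMean_sub_le_of_coupling hα0 hh0 hfbar hLip hp hmomμ hmomν hγ
  set D := ‖wMean α hα f μ - meanMeas μ - wMean α hα f ν + meanMeas ν‖
  set C := (L * Lam α hα fbar / hα) *
        ((∫ x, ‖x - meanMeas μ‖ ^ p ∂μ) ^ (1 / p) +
          (∫ x, ‖x - meanMeas ν‖ ^ p ∂ν) ^ (1 / p))
  have hC0 : 0 ≤ C := by positivity
  have hprod : μ.prod ν ∈ couplings μ ν := by simp [couplings]
  have cost : ∀ γ : Measure (EuclideanSpace ℝ (Fin d) × EuclideanSpace ℝ (Fin d)),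
      ∫⁻ z, ENNReal.ofReal (‖z.1 - z.2‖ ^ p) ∂γ =
        eLpNorm (fun z => z.1 - z.2) (ENNReal.ofReal p) γ ^ p := by
    intro γ
    rw [eLpNorm_eq_lintegral_rpow_enorm_toReal (by simpa using hp0) (by simp),
      ENNReal.toReal_ofReal hp0.le, one_div, ENNReal.rpow_inv_rpow hp0.ne']
    refine lintegral_congr fun z => ?_
    rw [← ENNReal.ofReal_rpow_of_nonneg (norm_nonneg _) hp0.le, ofReal_norm]
  have mem : ∀ γ ∈ couplings μ ν, MemLp (fun z => z.1 - z.2) (ENNReal.ofReal p) γ := by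
    intro γ hγ
    obtain ⟨h1, h2⟩ := memLp_fst_snd_of_mem_couplings hp0 hmomμ hmomν hγ
    exact h1.sub h2
  rcases hC0.eq_or_lt with hC | hC
  · simpa [← hC] using hbound _ hprod
  rw [← div_le_iff₀' hC, Wass]
  simp_rw [cost]
  have hfin : ⨅ γ ∈ couplings μ ν,
      eLpNorm (fun z => z.1 - z.2) (ENNReal.ofReal p) γ ^ p ≠ ⊤ :=
    ne_top_of_le_ne_top (ENNReal.rpow_ne_top_of_nonneg hp0.le (mem _ hprod).2.ne)
      (iInf₂_le (μ.prod ν) hprod)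
  rw [← ENNReal.ofReal_le_iff_le_toReal (ENNReal.rpow_ne_top_of_nonneg (by positivity) hfin),
    one_div, ENNReal.le_rpow_inv_iff hp0]
  refine le_iInf₂ fun γ hγ => ?_
  gcongr
  rw [← ofReal_lpNorm (mem γ hγ)]
  exact ENNReal.ofReal_le_ofReal ((div_le_iff₀' hC).2 (hbound γ hγ))

end
end

section
/- Assume that the Gibbs weight ω_f^α is Lipschitz continuous with Lipschitz constant L_{ω_f^α}. Then for all Borel probability measures μ, ν on ℝ^d with finite second moments, |m_f^h[μ] − m_f^h[ν]| ≤ (1 + (L_{ω_f^α} Λ_α / h(α))(V_2(μ)^{1/2} + V_2(ν)^{1/2})) · W_2(μ, ν). In particular, the regularized weighted mean m_f^h is Lipschitz with respect to the 2-Wasserstein distance on any set of probability measures with uniformly bounded centered second moments. -/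
open MeasureTheory Real

noncomputable section

section WeightedMean

variable {Ω E : Type*} [MeasurableSpace Ω] {P : Measure Ω}
  [NormedAddCommGroup E]

/-- If `g` is `L`-Lipschitz, then `‖g X - g Y‖ ≤ L ‖X - Y‖` in `L²`. -/
lemma sqrt_integral_sub_sq_le_of_lipschitzWith {L : NNReal} {g : E → ℝ} (hg : LipschitzWith L g)
    {X Y : Ω → E} (hXY : MemLp (fun ω => X ω - Y ω) 2 P) :
    √(∫ ω, (g (X ω) - g (Y ω)) ^ 2 ∂P) ≤ L * √(∫ ω, ‖X ω - Y ω‖ ^ 2 ∂P) := by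
  rw [← Real.sqrt_sq L.coe_nonneg, ← Real.sqrt_mul (sq_nonneg _), ← integral_const_mul]
  refine Real.sqrt_le_sqrt (integral_mono_of_nonneg (.of_forall fun _ => sq_nonneg _)
    ((hXY.norm.integrable_sq).const_mul _) (.of_forall fun ω => ?_))
  have h := hg.dist_le_mul (X ω) (Y ω)
  rw [Real.dist_eq, dist_eq_norm] at h
  calc (g (X ω) - g (Y ω)) ^ 2 = |g (X ω) - g (Y ω)| ^ 2 := (sq_abs _).symm
    _ ≤ (L * ‖X ω - Y ω‖) ^ 2 := by gcongr
    _ = _ := by ring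

lemma integral_sub_integral_sq_le [IsProbabilityMeasure P] {u : Ω → ℝ} (hu : MemLp u 2 P) (c : ℝ) :
    ∫ ω, (u ω - ∫ ω', u ω' ∂P) ^ 2 ∂P ≤ ∫ ω, (u ω - c) ^ 2 ∂P := by
  have hm : AEMeasurable u P := hu.1.aemeasurable
  have h := ProbabilityTheory.variance_le_expectation_sq (μ := P) (X := fun ω => u ω - c)
    (hu.1.sub aestronglyMeasurable_const)
  rw [ProbabilityTheory.variance_sub_const hu.1, ProbabilityTheory.variance_eq_integral hm] at h
  simpa using h

variable [NormedSpace ℝ E]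

/-- Cauchy–Schwarz inequality for the integral of a product of a scalar and a vector function. -/
lemma norm_integral_smul_le_sqrt_mul_sqrt {u : Ω → ℝ} {v : Ω → E}
    (hu : MemLp u 2 P) (hv : MemLp v 2 P) :
    ‖∫ ω, u ω • v ω ∂P‖ ≤ √(∫ ω, u ω ^ 2 ∂P) * √(∫ ω, ‖v ω‖ ^ 2 ∂P) := by
  have h := integral_mul_le_Lp_mul_Lq_of_nonneg (μ := P) Real.HolderConjugate.two_two
    (f := fun ω => ‖u ω‖) (g := fun ω => ‖v ω‖)
    (.of_forall fun _ => norm_nonneg _) (.of_forall fun _ => norm_nonneg _)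
    (by simpa using hu.norm) (by simpa using hv.norm)
  simp only [Real.rpow_two, ← Real.sqrt_eq_rpow, Real.norm_eq_abs, sq_abs] at h
  refine (norm_integral_le_integral_norm _).trans ?_
  simpa [norm_smul] using h

lemma norm_integral_le_sqrt [IsProbabilityMeasure P] {v : Ω → E} (hv : MemLp v 2 P) :
    ‖∫ ω, v ω ∂P‖ ≤ √(∫ ω, ‖v ω‖ ^ 2 ∂P) := by
  simpa using norm_integral_smul_le_sqrt_mul_sqrt (memLp_const (1 : ℝ)) hv

lemma integral_norm_le_sqrt [IsProbabilityMeasure P]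
    {F : Type*} [NormedAddCommGroup F] {v : Ω → F} (hv : MemLp v 2 P) :
    ∫ ω, ‖v ω‖ ∂P ≤ √(∫ ω, ‖v ω‖ ^ 2 ∂P) := by
  simpa using (le_abs_self _).trans (norm_integral_le_sqrt hv.norm)

lemma integral_sub_sub_sub {f₁ f₂ f₃ f₄ : Ω → E} (h₁ : Integrable f₁ P) (h₂ : Integrable f₂ P)
    (h₃ : Integrable f₃ P) (h₄ : Integrable f₄ P) :
    ∫ ω, (f₁ ω - f₂ ω - (f₃ ω - f₄ ω)) ∂P =
      ∫ ω, f₁ ω ∂P - ∫ ω, f₂ ω ∂P - (∫ ω, f₃ ω ∂P - ∫ ω, f₄ ω ∂P) := by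
  rw [← integral_sub h₁ h₂, ← integral_sub h₃ h₄]
  exact integral_sub (h₁.sub h₂) (h₃.sub h₄)

variable [CompleteSpace E]

/-- Decomposition of the difference of two weighted means. -/
lemma weighted_mean_sub_eq [IsProbabilityMeasure P] {a b : Ω → ℝ} {X Y : Ω → E}
    (ha : MemLp a 2 P) (hb : MemLp b 2 P) (hX : MemLp X 2 P) (hY : MemLp Y 2 P)
    (ha0 : ∫ ω, a ω ∂P ≠ 0) (hb0 : ∫ ω, b ω ∂P ≠ 0) :
    (∫ ω, a ω ∂P)⁻¹ • ∫ ω, a ω • X ω ∂P - (∫ ω, b ω ∂P)⁻¹ • ∫ ω, b ω • Y ω ∂P =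
      ∫ ω, (X ω - Y ω) ∂P
      + (∫ ω, a ω ∂P)⁻¹ • ∫ ω, (a ω - b ω) • (X ω - ∫ ω', X ω' ∂P) ∂P
      + ((∫ ω, a ω ∂P)⁻¹ * ∫ ω, (a ω - b ω) ∂P) •
        ∫ ω, ((∫ ω', b ω' ∂P)⁻¹ * ((∫ ω', b ω' ∂P) - b ω)) • (X ω - ∫ ω', X ω' ∂P) ∂P
      + (∫ ω, b ω ∂P)⁻¹ • ∫ ω, (b ω - ∫ ω', b ω' ∂P) • (X ω - Y ω) ∂P := by
  have ia := ha.integrable one_le_two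
  have ib := hb.integrable one_le_two
  have iX := hX.integrable one_le_two
  have iY := hY.integrable one_le_two
  have iaX : Integrable (fun ω => a ω • X ω) P := memLp_one_iff_integrable.1 (hX.smul ha)
  have ibX : Integrable (fun ω => b ω • X ω) P := memLp_one_iff_integrable.1 (hX.smul hb)
  have ibY : Integrable (fun ω => b ω • Y ω) P := memLp_one_iff_integrable.1 (hY.smul hb)
  set A := ∫ ω, a ω ∂P with hA
  set B := ∫ ω, b ω ∂P with hB
  set w := ∫ ω, X ω ∂P with hw
  have h₁ : ∫ ω, (a ω - b ω) • (X ω - w) ∂P =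
      ∫ ω, a ω • X ω ∂P - ∫ ω, b ω • X ω ∂P - (A - B) • w := by
    simp_rw [smul_sub, sub_smul]
    rw [integral_sub_sub_sub iaX ibX (ia.smul_const w) (ib.smul_const w),
      integral_smul_const, integral_smul_const]
  have h₂ : ∫ ω, (B⁻¹ * (B - b ω)) • (X ω - w) ∂P =
      B⁻¹ • (B • w - ∫ ω, b ω • X ω ∂P) := by
    simp_rw [mul_smul]
    rw [integral_smul]
    simp_rw [smul_sub, sub_smul]
    rw [integral_sub_sub_sub (f₁ := fun ω => B • X ω) (iX.smul B) ibX
        ((integrable_const B).smul_const w) (ib.smul_const w), integral_smul_const, integral_smul_const, integral_smul]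
    simp [← hB, ← hw, smul_sub]
  have h₃ : ∫ ω, (b ω - B) • (X ω - Y ω) ∂P =
      ∫ ω, b ω • X ω ∂P - ∫ ω, b ω • Y ω ∂P - B • (w - ∫ ω, Y ω ∂P) := by
    simp_rw [sub_smul, smul_sub]
    rw [integral_sub_sub_sub (f₃ := fun ω => B • X ω) (f₄ := fun ω => B • Y ω) ibX ibY
        (iX.smul B) (iY.smul B), integral_smul, integral_smul]
  rw [h₁, h₂, h₃, integral_sub iX iY, integral_sub ia ib, ← hA, ← hB, ← hw]
  match_scalars <;> field_simp <;> ring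

/-- Stability of the weighted mean with respect to the `L²` distance of the random variables,
for a Lipschitz weight with values in `[h, h * Λ]`. -/
lemma norm_weighted_mean_sub_le_s4 [IsProbabilityMeasure P]
    {L : NNReal} {g : E → ℝ} (hg : LipschitzWith L g) {h Λ : ℝ} (h0 : 0 < h)
    (hl : ∀ x, h ≤ g x) (hu : ∀ x, g x ≤ h * Λ) {X Y : Ω → E}
    (hX : MemLp X 2 P) (hY : MemLp Y 2 P) :
    ‖(∫ ω, g (X ω) ∂P)⁻¹ • ∫ ω, g (X ω) • X ω ∂P -
        (∫ ω, g (Y ω) ∂P)⁻¹ • ∫ ω, g (Y ω) • Y ω ∂P‖ ≤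
      (1 + L * Λ / h * (√(∫ ω, ‖X ω - ∫ ω', X ω' ∂P‖ ^ 2 ∂P) +
        √(∫ ω, ‖Y ω - ∫ ω', Y ω' ∂P‖ ^ 2 ∂P))) * √(∫ ω, ‖X ω - Y ω‖ ^ 2 ∂P) := by
  have hbdd (x : E) : ‖g x‖ ≤ h * Λ := by
    rw [Real.norm_of_nonneg (h0.le.trans (hl x))]; exact hu x
  have ha : MemLp (fun ω => g (X ω)) 2 P :=
    .of_bound (hg.continuous.comp_aestronglyMeasurable hX.1) _ (.of_forall fun _ => hbdd _)
  have hb : MemLp (fun ω => g (Y ω)) 2 P :=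
    .of_bound (hg.continuous.comp_aestronglyMeasurable hY.1) _ (.of_forall fun _ => hbdd _)
  have hΛ : 1 ≤ Λ := by
    have := (hl 0).trans (hu 0)
    exact (le_mul_iff_one_le_right h0).1 this
  have le_mean {Z : Ω → E} (hZ : MemLp (fun ω => g (Z ω)) 2 P) : h ≤ ∫ ω, g (Z ω) ∂P := by
    simpa using integral_mono (integrable_const h) (hZ.integrable one_le_two) fun ω => hl (Z ω)
  have mean_le {Z : Ω → E} (hZ : MemLp (fun ω => g (Z ω)) 2 P) : ∫ ω, g (Z ω) ∂P ≤ h * Λ := by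
    simpa using integral_mono (hZ.integrable one_le_two) (integrable_const (h * Λ))
      fun ω => hu (Z ω)
  have hA := le_mean ha
  have hB := le_mean hb
  have hB' := mean_le hb
  have hXY : MemLp (fun ω => X ω - Y ω) 2 P := hX.sub hY
  have hXc : MemLp (fun ω => X ω - ∫ ω', X ω' ∂P) 2 P := hX.sub (memLp_const _)
  have hYc : MemLp (fun ω => Y ω - ∫ ω', Y ω' ∂P) 2 P := hY.sub (memLp_const _)
  have hab : MemLp (fun ω => g (X ω) - g (Y ω)) 2 P := ha.sub hb
  rw [weighted_mean_sub_eq ha hb hX hY (h0.trans_le hA).ne' (h0.trans_le hB).ne']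
  set A := ∫ ω, g (X ω) ∂P
  set B := ∫ ω, g (Y ω) ∂P with hBdef
  set S := √(∫ ω, ‖X ω - Y ω‖ ^ 2 ∂P)
  set σX := √(∫ ω, ‖X ω - ∫ ω', X ω' ∂P‖ ^ 2 ∂P)
  set σY := √(∫ ω, ‖Y ω - ∫ ω', Y ω' ∂P‖ ^ 2 ∂P)
  have hS : 0 ≤ S := Real.sqrt_nonneg _
  have hσX : 0 ≤ σX := Real.sqrt_nonneg _
  have hσY : 0 ≤ σY := Real.sqrt_nonneg _
  have hgS := sqrt_integral_sub_sq_le_of_lipschitzWith hg hXY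
  have hAinv : A⁻¹ ≤ h⁻¹ := inv_anti₀ h0 hA
  have hBinv : B⁻¹ ≤ h⁻¹ := inv_anti₀ h0 hB
  have hA0 : 0 < A := h0.trans_le hA
  have hB0 : 0 < B := h0.trans_le hB
  have t₁ : ‖∫ ω, (X ω - Y ω) ∂P‖ ≤ S := norm_integral_le_sqrt hXY
  have t₂ : ‖A⁻¹ • ∫ ω, (g (X ω) - g (Y ω)) • (X ω - ∫ ω', X ω' ∂P) ∂P‖ ≤
      h⁻¹ * (L * S * σX) := by
    rw [norm_smul, Real.norm_of_nonneg (by positivity)]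
    have := (norm_integral_smul_le_sqrt_mul_sqrt hab hXc).trans
      (mul_le_mul_of_nonneg_right hgS hσX)
    gcongr
  have t₃ : ‖(A⁻¹ * ∫ ω, (g (X ω) - g (Y ω)) ∂P) •
      ∫ ω, (B⁻¹ * (B - g (Y ω))) • (X ω - ∫ ω', X ω' ∂P) ∂P‖ ≤
      h⁻¹ * (L * S) * ((Λ - 1) * σX) := by
    rw [norm_smul, norm_mul, Real.norm_of_nonneg (inv_nonneg.2 hA0.le)]
    have e₁ : ‖∫ ω, (g (X ω) - g (Y ω)) ∂P‖ ≤ L * S := by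
      have := norm_integral_le_sqrt hab
      simp only [Real.norm_eq_abs, sq_abs] at this hgS ⊢
      exact this.trans hgS
    have e₂ : ‖∫ ω, (B⁻¹ * (B - g (Y ω))) • (X ω - ∫ ω', X ω' ∂P) ∂P‖ ≤ (Λ - 1) * σX := by
      refine (norm_integral_le_of_norm_le ((hXc.norm.integrable one_le_two).const_mul (Λ - 1))
        (.of_forall fun ω => ?_)).trans ?_
      · rw [norm_smul]
        gcongr
        rw [norm_mul, Real.norm_of_nonneg (inv_nonneg.2 hB0.le), inv_mul_le_iff₀ hB0,
          Real.norm_eq_abs, abs_le]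
        constructor <;> nlinarith [hl (Y ω), hu (Y ω)]
      · rw [integral_const_mul]
        exact mul_le_mul_of_nonneg_left (integral_norm_le_sqrt hXc) (by linarith)
    have : 0 ≤ Λ - 1 := by linarith
    gcongr
  have t₄ : ‖B⁻¹ • ∫ ω, (g (Y ω) - B) • (X ω - Y ω) ∂P‖ ≤ h⁻¹ * (L * σY * S) := by
    rw [norm_smul, Real.norm_of_nonneg (inv_nonneg.2 hB0.le)]
    have hbc : MemLp (fun ω => g (Y ω) - B) 2 P := hb.sub (memLp_const _)
    have e := (Real.sqrt_le_sqrt (integral_sub_integral_sq_le hb (g (∫ ω', Y ω' ∂P)))).trans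
      (sqrt_integral_sub_sq_le_of_lipschitzWith hg hYc)
    have := (norm_integral_smul_le_sqrt_mul_sqrt hbc hXY).trans (mul_le_mul_of_nonneg_right e hS)
    gcongr
  have hlast : h⁻¹ * (L * σY * S) ≤ h⁻¹ * (L * σY * S) * Λ :=
    le_mul_of_one_le_right (by positivity) hΛ
  calc _ ≤ S + h⁻¹ * (L * S * σX) + h⁻¹ * (L * S) * ((Λ - 1) * σX) + h⁻¹ * (L * σY * S) * Λ :=
        norm_add_le_of_le (norm_add_le_of_le (norm_add_le_of_le t₁ t₂) t₃) (t₄.trans hlast)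
    _ = _ := by ring

end WeightedMean

/-- Lipschitz estimate for the regularized weighted mean in `W_2`:
`|m_f^h[μ] − m_f^h[ν]| ≤ (1 + (L Λ_α / h(α))(V_2(μ)^{1/2} + V_2(ν)^{1/2})) W_2(μ, ν)`. -/
theorem statement4 {d : ℕ} (α hα : ℝ) (hα0 : 0 < α) (hh0 : 0 < hα)
    (f : EuclideanSpace ℝ (Fin d) → ℝ) (hf : Measurable f)
    (fbar : ℝ) (hfbar : IsGLB (Set.range f) fbar)
    (L : NNReal) (hLip : LipschitzWith L (fun x => Real.exp (-α * f x)))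
    (μ ν : Measure (EuclideanSpace ℝ (Fin d)))
    [IsProbabilityMeasure μ] [IsProbabilityMeasure ν]
    (hmomμ : Integrable (fun x => ‖x‖ ^ 2) μ)
    (hmomν : Integrable (fun x => ‖x‖ ^ 2) ν) :
    ‖wMean α hα f μ - wMean α hα f ν‖ ≤
      (1 + (L * Lam α hα fbar / hα) *
          ((∫ x, ‖x - meanMeas μ‖ ^ 2 ∂μ) ^ ((1 : ℝ) / 2) +
            (∫ x, ‖x - meanMeas ν‖ ^ 2 ∂ν) ^ ((1 : ℝ) / 2))) *
        Wass 2 μ ν := by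
  have hL2 {ρ : Measure (EuclideanSpace ℝ (Fin d))} (h : Integrable (fun x => ‖x‖ ^ 2) ρ) :
      MemLp (fun x => x) 2 ρ := (memLp_two_iff_integrable_sq_norm aestronglyMeasurable_id).2 h
  have hg : LipschitzWith L (psiWeight α hα f) := by
    simpa [psiWeight, LipschitzWith] using hLip
  have hl (x) : hα ≤ psiWeight α hα f x := by
    have := Real.exp_pos (-α * f x)
    unfold psiWeight
    linarith
  have hu (x) : psiWeight α hα f x ≤ hα * Lam α hα fbar := by
    rw [Lam, mul_div_cancel₀ _ hh0.ne', psiWeight]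
    have : fbar ≤ f x := hfbar.1 ⟨x, rfl⟩
    gcongr ?_ + _
    exact Real.exp_le_exp.2 (by nlinarith)
  set K := 1 + (L * Lam α hα fbar / hα) *
    ((∫ x, ‖x - meanMeas μ‖ ^ 2 ∂μ) ^ ((1 : ℝ) / 2) +
      (∫ x, ‖x - meanMeas ν‖ ^ 2 ∂ν) ^ ((1 : ℝ) / 2)) with hK
  have hK0 : 0 < K := by
    have : 0 < Lam α hα fbar := div_pos (by positivity) hh0
    have : 0 ≤ ∫ x, ‖x - meanMeas μ‖ ^ 2 ∂μ := integral_nonneg fun _ => sq_nonneg _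
    have : 0 ≤ ∫ x, ‖x - meanMeas ν‖ ^ 2 ∂ν := integral_nonneg fun _ => sq_nonneg _
    positivity
  have hcost {γ} (hγ : γ ∈ couplings μ ν) :
      ∫⁻ z, ENNReal.ofReal (‖z.1 - z.2‖ ^ (2 : ℝ)) ∂γ =
        ENNReal.ofReal (∫ z, ‖z.1 - z.2‖ ^ 2 ∂γ) := by
    have hX := (hL2 (hγ.1 ▸ hmomμ)).comp_of_map (f := Prod.fst) measurable_fst.aemeasurable
    have hY := (hL2 (hγ.2 ▸ hmomν)).comp_of_map (f := Prod.snd) measurable_snd.aemeasurable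
    simp_rw [Real.rpow_two]
    exact (ofReal_integral_eq_lintegral_ofReal (hX.sub hY).norm.integrable_sq
      (.of_forall fun _ => sq_nonneg _)).symm
  have hbound {γ} (hγ : γ ∈ couplings μ ν) :
      ‖wMean α hα f μ - wMean α hα f ν‖ ≤ K * √(∫ z, ‖z.1 - z.2‖ ^ 2 ∂γ) := by
    have hX := (hL2 (hγ.1 ▸ hmomμ)).comp_of_map (f := Prod.fst) measurable_fst.aemeasurable
    have hY := (hL2 (hγ.2 ▸ hmomν)).comp_of_map (f := Prod.snd) measurable_snd.aemeasurable
    have : IsProbabilityMeasure (γ.map Prod.fst) := by rw [hγ.1]; infer_instance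
    have : IsProbabilityMeasure γ :=
      Measure.isProbabilityMeasure_of_map Prod.fst
    have hψ := hg.continuous
    have h := norm_weighted_mean_sub_le_s4 hg hh0 hl hu hX hY
    have e₁ {F : Type} [NormedAddCommGroup F] [NormedSpace ℝ F]
        (φ : EuclideanSpace ℝ (Fin d) → F) (hφ : Continuous φ) :
        ∫ x, φ x ∂μ = ∫ z, φ z.1 ∂γ := by
      rw [← hγ.1, integral_map measurable_fst.aemeasurable hφ.aestronglyMeasurable]
    have e₂ {F : Type} [NormedAddCommGroup F] [NormedSpace ℝ F]
        (φ : EuclideanSpace ℝ (Fin d) → F) (hφ : Continuous φ) :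
        ∫ x, φ x ∂ν = ∫ z, φ z.2 ∂γ := by
      rw [← hγ.2, integral_map measurable_snd.aemeasurable hφ.aestronglyMeasurable]
    rw [hK, wMean, wMean, ← Real.sqrt_eq_rpow, ← Real.sqrt_eq_rpow,
      e₁ (fun x => ‖x - meanMeas μ‖ ^ 2) (by fun_prop),
      e₂ (fun x => ‖x - meanMeas ν‖ ^ 2) (by fun_prop), meanMeas, meanMeas,
      e₁ _ hψ, e₂ _ hψ, e₁ (fun x => psiWeight α hα f x • x) (by fun_prop),
      e₂ (fun x => psiWeight α hα f x • x) (by fun_prop),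
      e₁ (fun x => x) continuous_id, e₂ (fun x => x) continuous_id]
    exact h
  set R := ‖wMean α hα f μ - wMean α hα f ν‖
  have hle : ENNReal.ofReal ((R / K) ^ 2) ≤
      ⨅ γ ∈ couplings μ ν, ∫⁻ z, ENNReal.ofReal (‖z.1 - z.2‖ ^ (2 : ℝ)) ∂γ := by
    refine le_iInf₂ fun γ hγ => ?_
    rw [hcost hγ]
    refine ENNReal.ofReal_le_ofReal ((Real.le_sqrt ?_ ?_).1 ?_)
    · exact div_nonneg (norm_nonneg _) hK0.le
    · exact integral_nonneg fun _ => sq_nonneg _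
    · exact (div_le_iff₀' hK0).2 (hbound hγ)
  have hfin : (⨅ γ ∈ couplings μ ν, ∫⁻ z, ENNReal.ofReal (‖z.1 - z.2‖ ^ (2 : ℝ)) ∂γ) ≠ ⊤ := by
    have hprod : μ.prod ν ∈ couplings μ ν := ⟨by simp, by simp⟩
    exact ne_top_of_le_ne_top (hcost hprod ▸ ENNReal.ofReal_ne_top) (iInf₂_le _ hprod)
  rw [← div_le_iff₀' hK0, Wass, ← ENNReal.toReal_rpow, ← Real.sqrt_eq_rpow]
  exact Real.le_sqrt_of_sq_le ((ENNReal.ofReal_le_iff_le_toReal hfin).1 hle)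

end
end

section
/- (Local Lipschitz estimate for the consensus drift, Lemma B.1, first part.) Suppose additionally that f is continuously differentiable. Let N ∈ ℕ, k > 0, and set c_k := √2 · α · sup_{|x| ≤ k} |∇f(x)| e^{−α f(x)}. Then for all 𝐗 = (X^1,…,X^N) and 𝐗̃ = (X̃^1,…,X̃^N) in (ℝ^d)^N with |𝐗| ≤ k and |𝐗̃| ≤ k, and every 1 ≤ i ≤ N, |F_N^i(𝐗) − F_N^i(𝐗̃)| ≤ |X^i − X̃^i| + ( Λ_α/√N + (c_k (1 + Λ_α))/(N h(α)) · √(N |X̃^i|² + |𝐗̃|²) ) · |𝐗 − 𝐗̃|. -/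
open MeasureTheory Real

noncomputable section

/-- The drift component
`F_N^i(𝐗) = (Σ_j (X^i − X^j) ψ_h(X^j)) / (Σ_j ψ_h(X^j))`. -/
def driftF {d : ℕ} (α hα : ℝ) (f : EuclideanSpace ℝ (Fin d) → ℝ) {N : ℕ}
    (X : Fin N → EuclideanSpace ℝ (Fin d)) (i : Fin N) : EuclideanSpace ℝ (Fin d) :=
  (∑ j, psiWeight α hα f (X j))⁻¹ • ∑ j, psiWeight α hα f (X j) • (X i - X j)

/-- The Euclidean norm of `𝐗 ∈ (ℝ^d)^N`, viewed as a vector in `ℝ^{Nd}`. -/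
def bigNorm {d N : ℕ} (X : Fin N → EuclideanSpace ℝ (Fin d)) : ℝ :=
  Real.sqrt (∑ i, ‖X i‖ ^ 2)

/-- Cauchy–Schwarz for linear combinations of the components of a particle configuration. -/
lemma norm_sum_smul_le_bigNorm {d N : ℕ} (a : Fin N → ℝ)
    (u : Fin N → EuclideanSpace ℝ (Fin d)) :
    ‖∑ j, a j • u j‖ ≤ Real.sqrt (∑ j, a j ^ 2) * bigNorm u := by
  calc ‖∑ j, a j • u j‖ ≤ ∑ j, |a j| * ‖u j‖ := by
        refine (norm_sum_le _ _).trans_eq ?_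
        simp [norm_smul]
    _ ≤ Real.sqrt (∑ j, |a j| ^ 2) * Real.sqrt (∑ j, ‖u j‖ ^ 2) :=
        Real.sum_mul_le_sqrt_mul_sqrt _ _ _
    _ = _ := by simp [bigNorm]

lemma bigNorm_nonneg {d N : ℕ} (u : Fin N → EuclideanSpace ℝ (Fin d)) : 0 ≤ bigNorm u :=
  Real.sqrt_nonneg _

lemma norm_le_bigNorm {d N : ℕ} (u : Fin N → EuclideanSpace ℝ (Fin d)) (j : Fin N) :
    ‖u j‖ ≤ bigNorm u :=
  Real.le_sqrt_of_sq_le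
    (Finset.single_le_sum (f := fun j => ‖u j‖ ^ 2) (fun _ _ => sq_nonneg _) (Finset.mem_univ j))

lemma card_mul_le_sum {N : ℕ} {w : Fin N → ℝ} {h : ℝ} (hw : ∀ j, h ≤ w j) :
    N * h ≤ ∑ j, w j := by
  simpa using Finset.card_nsmul_le_sum Finset.univ w h (fun j _ => hw j)

lemma norm_weightedMean_le {d N : ℕ} (hN : 1 ≤ N) {h M : ℝ} (hh : 0 < h) {w : Fin N → ℝ}
    (hw : ∀ j, h ≤ w j) (hwM : ∀ j, w j ≤ M) (u : Fin N → EuclideanSpace ℝ (Fin d)) :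
    ‖(∑ j, w j)⁻¹ • ∑ j, w j • u j‖ ≤ M / h / Real.sqrt N * bigNorm u := by
  have hN0 : (0 : ℝ) < N := by exact_mod_cast hN
  have hsN : 0 < Real.sqrt N := Real.sqrt_pos.2 hN0
  have hM : 0 ≤ M := hh.le.trans ((hw ⟨0, hN⟩).trans (hwM _))
  have hW := card_mul_le_sum hw
  have hNh : 0 < N * h := by positivity
  have hsq : Real.sqrt (∑ j, w j ^ 2) ≤ Real.sqrt N * M := by
    rw [← Real.sqrt_sq hM, ← Real.sqrt_mul hN0.le]
    refine Real.sqrt_le_sqrt ?_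
    simpa using Finset.sum_le_card_nsmul Finset.univ (fun j => w j ^ 2) (M ^ 2)
      (fun j _ => pow_le_pow_left₀ (hh.le.trans (hw j)) (hwM j) 2)
  rw [norm_smul, norm_inv, Real.norm_of_nonneg (hNh.le.trans hW)]
  calc (∑ j, w j)⁻¹ * ‖∑ j, w j • u j‖
      ≤ (N * h)⁻¹ * (Real.sqrt N * M * bigNorm u) := by
        have := norm_sum_smul_le_bigNorm w u
        have hu := bigNorm_nonneg u
        gcongr
        exact this.trans (by gcongr)
    _ = M / h / Real.sqrt N * bigNorm u := by
        have : (N : ℝ) = Real.sqrt N * Real.sqrt N := (Real.mul_self_sqrt hN0.le).symm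
        rw [this, Real.sqrt_mul_self hsN.le]
        field_simp

lemma bigNorm_sub_const_sq_le {d N : ℕ} (u : Fin N → EuclideanSpace ℝ (Fin d))
    (y : EuclideanSpace ℝ (Fin d)) :
    bigNorm (fun j => u j - y) ^ 2 ≤ 2 * (bigNorm u ^ 2 + N * ‖y‖ ^ 2) := by
  unfold bigNorm
  rw [Real.sq_sqrt (by positivity), Real.sq_sqrt (by positivity)]
  calc ∑ j, ‖u j - y‖ ^ 2 ≤ ∑ j, 2 * (‖u j‖ ^ 2 + ‖y‖ ^ 2) := by
        refine Finset.sum_le_sum fun j _ => ?_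
        have h1 := norm_sub_le (u j) y
        nlinarith [norm_nonneg (u j - y), sq_nonneg (‖u j‖ - ‖y‖)]
    _ = _ := by
        rw [← Finset.mul_sum, Finset.sum_add_distrib]
        simp

/-- The difference of two weighted means of the same points, for different weights. -/
lemma norm_weightedMean_sub_le {d N : ℕ} (hN : 1 ≤ N) {h M : ℝ} (hh : 0 < h)
    {v w : Fin N → ℝ} (hv : ∀ j, h ≤ v j) (hvM : ∀ j, v j ≤ M) (hw : ∀ j, h ≤ w j)
    (u : Fin N → EuclideanSpace ℝ (Fin d)) :
    ‖(∑ j, w j)⁻¹ • ∑ j, w j • u j - (∑ j, v j)⁻¹ • ∑ j, v j • u j‖ ≤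
      Real.sqrt (∑ j, (w j - v j) ^ 2) / (N * h) *
        (Real.sqrt 2 * (1 + M / h) * bigNorm u) := by
  have hN0 : (0 : ℝ) < N := by exact_mod_cast hN
  have hM : 0 ≤ M := hh.le.trans ((hv ⟨0, hN⟩).trans (hvM _))
  have hNh : 0 < N * h := by positivity
  have hW := card_mul_le_sum hw
  have hV := card_mul_le_sum hv
  have hu := bigNorm_nonneg u
  have hmean := norm_weightedMean_le hN hh hv hvM u
  set y := (∑ j, v j)⁻¹ • ∑ j, v j • u j with hy
  have hvy : ∑ j, v j • u j = (∑ j, v j) • y := by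
    rw [hy, smul_inv_smul₀ (hNh.trans_le hV).ne']
  have hsum : (∑ j, w j)⁻¹ • ∑ j, w j • u j - y =
      (∑ j, w j)⁻¹ • ∑ j, (w j - v j) • (u j - y) := by
    have : ∑ j, (w j - v j) • (u j - y) = ∑ j, w j • u j - (∑ j, w j) • y := by
      simp only [smul_sub, sub_smul, Finset.sum_sub_distrib, ← Finset.sum_smul, hvy]
      abel
    rw [this, smul_sub, inv_smul_smul₀ (hNh.trans_le hW).ne']
  have hdev : bigNorm (fun j => u j - y) ≤ Real.sqrt 2 * (1 + M / h) * bigNorm u := by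
    refine le_of_sq_le_sq ?_ (by positivity)
    refine (bigNorm_sub_const_sq_le u y).trans ?_
    have hNy : N * ‖y‖ ^ 2 ≤ (M / h) ^ 2 * bigNorm u ^ 2 := by
      calc N * ‖y‖ ^ 2 ≤ N * (M / h / Real.sqrt N * bigNorm u) ^ 2 := by gcongr
        _ = _ := by
          rw [mul_pow, div_pow _ (Real.sqrt N), Real.sq_sqrt hN0.le]
          field_simp
    have hMh : 0 ≤ M / h := by positivity
    rw [mul_pow, mul_pow, Real.sq_sqrt (by norm_num)]
    nlinarith [mul_nonneg hMh (sq_nonneg (bigNorm u))]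
  rw [hsum, norm_smul, norm_inv, Real.norm_of_nonneg (hNh.le.trans hW)]
  calc (∑ j, w j)⁻¹ * ‖∑ j, (w j - v j) • (u j - y)‖
      ≤ (N * h)⁻¹ * (Real.sqrt (∑ j, (w j - v j) ^ 2) *
          (Real.sqrt 2 * (1 + M / h) * bigNorm u)) := by
        gcongr
        exact (norm_sum_smul_le_bigNorm _ _).trans (by gcongr)
    _ = _ := by ring

lemma norm_gradient {d : ℕ} (f : EuclideanSpace ℝ (Fin d) → ℝ) (x : EuclideanSpace ℝ (Fin d)) :
    ‖gradient f x‖ = ‖fderiv ℝ f x‖ := by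
  simp [gradient]

/-- The weight `psiWeight` is Lipschitz on the closed ball of radius `k`. -/
lemma abs_psiWeight_sub_le {d : ℕ} {α : ℝ} (hα0 : 0 < α) (hα k : ℝ)
    {f : EuclideanSpace ℝ (Fin d) → ℝ} (hf : ContDiff ℝ 1 f)
    {x y : EuclideanSpace ℝ (Fin d)} (hx : ‖x‖ ≤ k) (hy : ‖y‖ ≤ k) :
    |psiWeight α hα f x - psiWeight α hα f y| ≤
      α * (⨆ x : {y : EuclideanSpace ℝ (Fin d) // ‖y‖ ≤ k},
        ‖gradient f x.1‖ * Real.exp (-α * f x.1)) * ‖x - y‖ := by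
  have hcont : Continuous fun x => ‖gradient f x‖ * Real.exp (-α * f x) := by
    simp only [norm_gradient]
    have h1 := hf.continuous_fderiv one_ne_zero
    have h2 := hf.continuous
    fun_prop
  have hbdd : BddAbove (Set.range fun x : {y : EuclideanSpace ℝ (Fin d) // ‖y‖ ≤ k} =>
      ‖gradient f x.1‖ * Real.exp (-α * f x.1)) := by
    refine ((isCompact_closedBall (0 : EuclideanSpace ℝ (Fin d)) k).bddAbove_image
      hcont.continuousOn).mono ?_
    rintro _ ⟨z, rfl⟩
    exact ⟨z.1, by simpa using z.2, rfl⟩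
  have hderiv : ∀ z, HasFDerivAt (psiWeight α hα f)
      (Real.exp (-α * f z) • (-α) • fderiv ℝ f z) z := fun z =>
    ((((hf.differentiable one_ne_zero) z).hasFDerivAt.const_mul (-α)).exp).add_const hα
  refine (convex_closedBall 0 k).norm_image_sub_le_of_norm_hasFDerivWithin_le
    (fun z _ => (hderiv z).hasFDerivWithinAt) (fun z hz => ?_) (by simpa using hy)
    (by simpa using hx)
  have hle := le_ciSup hbdd ⟨z, by simpa using hz⟩
  rw [norm_smul, norm_smul, Real.norm_of_nonneg (Real.exp_pos _).le, norm_neg,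
    Real.norm_of_nonneg hα0.le, ← norm_gradient]
  calc Real.exp (-α * f z) * (α * ‖gradient f z‖)
      = α * (‖gradient f z‖ * Real.exp (-α * f z)) := by ring
    _ ≤ _ := by gcongr

lemma driftF_eq_sub {d N : ℕ} (α hα : ℝ) (f : EuclideanSpace ℝ (Fin d) → ℝ)
    (X : Fin N → EuclideanSpace ℝ (Fin d)) (i : Fin N)
    (hS : ∑ j, psiWeight α hα f (X j) ≠ 0) :
    driftF α hα f X i = X i -
      (∑ j, psiWeight α hα f (X j))⁻¹ • ∑ j, psiWeight α hα f (X j) • X j := by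
  simp only [driftF, smul_sub, Finset.sum_sub_distrib, ← Finset.sum_smul]
  rw [inv_smul_smul₀ hS]

/-- local Lipschitz estimate for the consensus drift:
with `c_k := √2 α sup_{|x| ≤ k} |∇f(x)| e^{−α f(x)}`, for `|𝐗|, |𝐗̃| ≤ k`,
`|F_N^i(𝐗) − F_N^i(𝐗̃)| ≤ |X^i − X̃^i|
  + (Λ_α/√N + c_k(1+Λ_α)/(N h(α)) √(N|X̃^i|² + |𝐗̃|²)) |𝐗 − 𝐗̃|`. -/
theorem statement5 {d : ℕ} (α hα : ℝ) (hα0 : 0 < α) (hh0 : 0 < hα)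
    (f : EuclideanSpace ℝ (Fin d) → ℝ) (hf : ContDiff ℝ 1 f)
    (fbar : ℝ) (hfbar : IsGLB (Set.range f) fbar)
    (N : ℕ) (hN : 1 ≤ N) (k : ℝ) (hk : 0 < k)
    (X Xt : Fin N → EuclideanSpace ℝ (Fin d))
    (hX : bigNorm X ≤ k) (hXt : bigNorm Xt ≤ k) (i : Fin N) :
    ‖driftF α hα f X i - driftF α hα f Xt i‖ ≤
      ‖X i - Xt i‖ +
        (Lam α hα fbar / Real.sqrt N +
            (Real.sqrt 2 * α *
                (⨆ x : {y : EuclideanSpace ℝ (Fin d) // ‖y‖ ≤ k},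
                  ‖gradient f x.1‖ * Real.exp (-α * f x.1))) *
              (1 + Lam α hα fbar) / (N * hα) *
              Real.sqrt (N * ‖Xt i‖ ^ 2 + bigNorm Xt ^ 2)) *
          bigNorm (fun j => X j - Xt j) := by
  have hN0 : (0 : ℝ) < N := by exact_mod_cast hN
  have hNh : 0 < N * hα := by positivity
  have hlow : ∀ x, hα ≤ psiWeight α hα f x := fun x => by
    have := Real.exp_pos (-α * f x)
    unfold psiWeight
    linarith
  have hup : ∀ x, psiWeight α hα f x ≤ Real.exp (-α * fbar) + hα := fun x => by
    have : fbar ≤ f x := hfbar.1 ⟨x, rfl⟩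
    have : -α * f x ≤ -α * fbar := by nlinarith
    unfold psiWeight
    gcongr
  have hS : ∀ Z : Fin N → EuclideanSpace ℝ (Fin d), ∑ j, psiWeight α hα f (Z j) ≠ 0 := fun Z =>
    (hNh.trans_le (card_mul_le_sum fun j => hlow (Z j))).ne'
  set K := ⨆ x : {y : EuclideanSpace ℝ (Fin d) // ‖y‖ ≤ k},
    ‖gradient f x.1‖ * Real.exp (-α * f x.1) with hK
  have hK0 : 0 ≤ K := Real.iSup_nonneg fun x => by positivity
  set w : Fin N → ℝ := fun j => psiWeight α hα f (X j) with hw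
  set v : Fin N → ℝ := fun j => psiWeight α hα f (Xt j) with hv
  set D : Fin N → EuclideanSpace ℝ (Fin d) := fun j => X j - Xt j with hD
  have hD0 := bigNorm_nonneg D
  have hwv : Real.sqrt (∑ j, (w j - v j) ^ 2) ≤ α * K * bigNorm D := by
    unfold bigNorm
    rw [← Real.sqrt_sq (show 0 ≤ α * K by positivity), ← Real.sqrt_mul (sq_nonneg _),
      Finset.mul_sum]
    refine Real.sqrt_le_sqrt (Finset.sum_le_sum fun j _ => ?_)
    rw [← mul_pow, ← sq_abs]
    exact pow_le_pow_left₀ (abs_nonneg _) (abs_psiWeight_sub_le hα0 hα k hf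
      ((norm_le_bigNorm X j).trans hX) ((norm_le_bigNorm Xt j).trans hXt)) 2
  have hdecomp : driftF α hα f X i - driftF α hα f Xt i = (X i - Xt i) -
      (∑ j, w j)⁻¹ • ∑ j, w j • D j -
      ((∑ j, w j)⁻¹ • ∑ j, w j • Xt j - (∑ j, v j)⁻¹ • ∑ j, v j • Xt j) := by
    rw [driftF_eq_sub α hα f X i (hS X), driftF_eq_sub α hα f Xt i (hS Xt)]
    simp only [hw, hv, hD, smul_sub, Finset.sum_sub_distrib]
    abel
  have hL : 0 ≤ Lam α hα fbar := by unfold Lam; positivity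
  have hmean : ‖(∑ j, w j)⁻¹ • ∑ j, w j • D j‖ ≤ Lam α hα fbar / Real.sqrt N * bigNorm D :=
    norm_weightedMean_le hN hh0 (fun j => hlow (X j)) (fun j => hup (X j)) D
  have hweights :
      ‖(∑ j, w j)⁻¹ • ∑ j, w j • Xt j - (∑ j, v j)⁻¹ • ∑ j, v j • Xt j‖ ≤
        Real.sqrt (∑ j, (w j - v j) ^ 2) / (N * hα) *
          (Real.sqrt 2 * (1 + Lam α hα fbar) * bigNorm Xt) :=
    norm_weightedMean_sub_le hN hh0 (fun j => hlow (Xt j)) (fun j => hup (Xt j))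
      (fun j => hlow (X j)) Xt
  have hXt_le : bigNorm Xt ≤ Real.sqrt (N * ‖Xt i‖ ^ 2 + bigNorm Xt ^ 2) :=
    Real.le_sqrt_of_sq_le (le_add_of_nonneg_left (by positivity))
  rw [hdecomp]
  calc _ ≤ ‖X i - Xt i‖ + ‖(∑ j, w j)⁻¹ • ∑ j, w j • D j‖ +
        ‖(∑ j, w j)⁻¹ • ∑ j, w j • Xt j - (∑ j, v j)⁻¹ • ∑ j, v j • Xt j‖ :=
        (norm_sub_le _ _).trans (by gcongr; exact norm_sub_le _ _)
    _ ≤ ‖X i - Xt i‖ + Lam α hα fbar / Real.sqrt N * bigNorm D +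
        α * K * bigNorm D / (N * hα) * (Real.sqrt 2 * (1 + Lam α hα fbar) *
          Real.sqrt (N * ‖Xt i‖ ^ 2 + bigNorm Xt ^ 2)) := by
        refine add_le_add (add_le_add le_rfl hmean) (hweights.trans ?_)
        have := bigNorm_nonneg Xt
        gcongr
    _ = _ := by ring

end
end

section
/- Let m ≥ 1 be real, N ≥ 1, and x_1, …, x_N ∈ ℝ^d, with arithmetic mean x̄ := (1/N) Σ_{k=1}^N x_k and regularized weighted mean m^h. Then for every 1 ≤ i ≤ N, |x_i − m^h|^m ≤ 2^{m−1} |x_i − x̄|^m + (2^{m−1} Λ_α / N) Σ_{k=1}^N |x_k − x̄|^m. -/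
open MeasureTheory Real

noncomputable section

/-- A weighted mean with weights between `a > 0` and `b` satisfies Jensen's inequality for
`‖·‖ ^ p` against the uniform mean, up to the factor `b / a`. -/
theorem norm_sub_centerMass_rpow_le {E ι : Type*} [NormedAddCommGroup E] [NormedSpace ℝ E]
    [Fintype ι] [Nonempty ι] {a b p : ℝ} (ha : 0 < a) (hp : 1 ≤ p) {w : ι → ℝ}
    (haw : ∀ k, a ≤ w k) (hwb : ∀ k, w k ≤ b) (x : ι → E) (c : E) :
    ‖c - Finset.univ.centerMass w x‖ ^ p ≤ b / a / Fintype.card ι * ∑ k, ‖x k - c‖ ^ p := by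
  have hw k : 0 < w k := ha.trans_le (haw k)
  have hW : 0 < ∑ k, w k := Finset.sum_pos (fun k _ => hw k) Finset.univ_nonempty
  have hcard : Fintype.card ι * a ≤ ∑ k, w k := by
    simpa using Finset.card_nsmul_le_sum Finset.univ w a fun k _ => haw k
  have hconv : ConvexOn ℝ Set.univ fun y : E => ‖y - c‖ ^ p := by
    have h := convexOn_univ_dist c
    simp only [dist_eq_norm] at h
    refine ⟨convex_univ, fun y _ z _ s t hs ht hst => ?_⟩
    have hnorm := h.2 (Set.mem_univ y) (Set.mem_univ z) hs ht hst
    exact (rpow_le_rpow (norm_nonneg _) hnorm (zero_le_one.trans hp)).trans <|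
      (convexOn_rpow hp).2 (norm_nonneg _) (norm_nonneg _) hs ht hst
  calc ‖c - Finset.univ.centerMass w x‖ ^ p
      = ‖Finset.univ.centerMass w x - c‖ ^ p := by rw [norm_sub_rev]
    _ ≤ Finset.univ.centerMass w fun k => ‖x k - c‖ ^ p :=
        hconv.map_centerMass_le (fun k _ => (hw k).le) hW fun _ _ => trivial
    _ = (∑ k, w k)⁻¹ * ∑ k, w k * ‖x k - c‖ ^ p := rfl
    _ ≤ (Fintype.card ι * a)⁻¹ * ∑ k, b * ‖x k - c‖ ^ p := by
        gcongr with k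
        · exact Finset.sum_nonneg fun k _ => mul_nonneg (hw k).le (by positivity)
        · exact hwb k
    _ = b / a / Fintype.card ι * ∑ k, ‖x k - c‖ ^ p := by
        rw [← Finset.mul_sum]
        field_simp

/-- with `x̄` the arithmetic mean and `m^h` the regularized weighted mean,
`|x_i − m^h|^m ≤ 2^{m−1}|x_i − x̄|^m + (2^{m−1}Λ_α/N) Σ_k |x_k − x̄|^m`. -/
theorem statement15 {d : ℕ} (α hα : ℝ) (hα0 : 0 < α) (hh0 : 0 < hα)
    (f : EuclideanSpace ℝ (Fin d) → ℝ) (fbar : ℝ) (hfbar : IsGLB (Set.range f) fbar)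
    (m : ℝ) (hm : 1 ≤ m) (N : ℕ) (hN : 1 ≤ N)
    (x : Fin N → EuclideanSpace ℝ (Fin d)) (i : Fin N) :
    ‖x i - wMeanPts α hα f x‖ ^ m ≤
      (2 : ℝ) ^ (m - 1) * ‖x i - (N : ℝ)⁻¹ • ∑ k, x k‖ ^ m +
        (2 : ℝ) ^ (m - 1) * Lam α hα fbar / N *
          ∑ k, ‖x k - (N : ℝ)⁻¹ • ∑ j, x j‖ ^ m := by
  have : Nonempty (Fin N) := ⟨i⟩
  set c := (N : ℝ)⁻¹ • ∑ k, x k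
  have hmean : ‖c - wMeanPts α hα f x‖ ^ m ≤ Lam α hα fbar / N * ∑ k, ‖x k - c‖ ^ m := by
    have h := norm_sub_centerMass_rpow_le (w := fun k => psiWeight α hα f (x k))
      (b := Real.exp (-α * fbar) + hα) hh0 hm
      (fun k => le_add_of_nonneg_left (Real.exp_nonneg _))
      (fun k => by
        have hf : fbar ≤ f (x k) := hfbar.1 ⟨x k, rfl⟩
        have hmul := mul_le_mul_of_nonneg_left hf hα0.le
        exact add_le_add_left (Real.exp_le_exp.2 (by linarith)) _) x c
    rwa [Fintype.card_fin] at h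
  calc ‖x i - wMeanPts α hα f x‖ ^ m
      ≤ (‖x i - c‖ + ‖c - wMeanPts α hα f x‖) ^ m := by
        gcongr
        exact norm_sub_le_norm_sub_add_norm_sub _ _ _
    _ ≤ 2 ^ (m - 1) * (‖x i - c‖ ^ m + ‖c - wMeanPts α hα f x‖ ^ m) := by
        exact_mod_cast NNReal.rpow_add_le_mul_rpow_add_rpow ‖x i - c‖₊ ‖c - wMeanPts α hα f x‖₊ hm
    _ ≤ 2 ^ (m - 1) * (‖x i - c‖ ^ m + Lam α hα fbar / N * ∑ k, ‖x k - c‖ ^ m) := by gcongr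
    _ = _ := by ring

end
end

section
/- Let p ≥ 1 be real and let ρ be a Borel probability measure on ℝ^d with finite p-th moment. Then ∫_{ℝ^d} |x − m_f^h[ρ]|^p ρ(dx) ≤ 2^{p−1} (1 + Λ_α) ∫_{ℝ^d} |x − M(ρ)|^p ρ(dx), i.e. the p-th moment of ρ about its regularized weighted mean is at most 2^{p−1}(1+Λ_α) times its centered p-th moment. -/
open MeasureTheory Real

noncomputable section

/-- Jensen's inequality for `t ↦ t ^ p` with respect to an unnormalized weight. -/
theorem rpow_weighted_integral_le {Ω : Type*} [MeasurableSpace Ω] {μ : Measure Ω} {w g : Ω → ℝ}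
    {p : ℝ} (hp : 1 ≤ p) (hw : ∀ x, 0 ≤ w x) (hg : ∀ x, 0 ≤ g x) (hwi : Integrable w μ)
    (hwg : Integrable (fun x => w x * g x) μ) (hwgp : Integrable (fun x => w x * g x ^ p) μ)
    (hZ : 0 < ∫ x, w x ∂μ) :
    ((∫ x, w x ∂μ)⁻¹ * ∫ x, w x * g x ∂μ) ^ p ≤ (∫ x, w x ∂μ)⁻¹ * ∫ x, w x * g x ^ p ∂μ := by
  set Z := ∫ x, w x ∂μ
  set a := Z⁻¹ * ∫ x, w x * g x ∂μ with ha
  have ha0 : 0 ≤ a := mul_nonneg (inv_nonneg.2 hZ.le)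
    (integral_nonneg fun x => mul_nonneg (hw x) (hg x))
  rcases ha0.eq_or_lt with h0 | hpos
  · rw [← h0, Real.zero_rpow (by linarith)]
    exact mul_nonneg (inv_nonneg.2 hZ.le)
      (integral_nonneg fun x => mul_nonneg (hw x) (Real.rpow_nonneg (hg x) p))
  have hap : 0 < a ^ p := Real.rpow_pos_of_pos hpos p
  have hint : ∫ x, w x * g x ∂μ = Z * a := by
    rw [ha]; field_simp
  have tangent : ∀ x, (1 - p) * w x + p / a * (w x * g x) ≤ (a ^ p)⁻¹ * (w x * g x ^ p) := by
    intro x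
    have hb := one_add_mul_self_le_rpow_one_add
      (s := g x / a - 1) (by linarith [div_nonneg (hg x) ha0]) hp
    rw [add_sub_cancel, Real.div_rpow (hg x) ha0] at hb
    calc (1 - p) * w x + p / a * (w x * g x) = w x * (1 + p * (g x / a - 1)) := by ring
      _ ≤ w x * (g x ^ p / a ^ p) := mul_le_mul_of_nonneg_left hb (hw x)
      _ = (a ^ p)⁻¹ * (w x * g x ^ p) := by ring
  have h := integral_mono ((hwi.const_mul (1 - p)).add (hwg.const_mul (p / a)))
    (hwgp.const_mul (a ^ p)⁻¹) tangent
  simp only [Pi.add_apply] at h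
  rw [integral_add (hwi.const_mul _) (hwg.const_mul _), integral_const_mul, integral_const_mul,
    integral_const_mul, hint] at h
  have hZle : Z ≤ (a ^ p)⁻¹ * ∫ x, w x * g x ^ p ∂μ := by
    refine le_trans (le_of_eq ?_) h
    change Z = (1 - p) * Z + p / a * (Z * a)
    field_simp
    ring
  rw [inv_mul_eq_div, le_div_iff₀ hap] at hZle
  rw [inv_mul_eq_div, le_div_iff₀ hZ]
  linarith

/-- The convexity bound `‖x - m‖ ^ p ≤ 2 ^ (p - 1) * (‖x - c‖ ^ p + ‖m - c‖ ^ p)`. -/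
theorem norm_sub_rpow_le {E : Type*} [SeminormedAddCommGroup E] {p : ℝ} (hp : 1 ≤ p)
    (x m c : E) : ‖x - m‖ ^ p ≤ 2 ^ (p - 1) * (‖x - c‖ ^ p + ‖m - c‖ ^ p) := by
  have h : ‖x - m‖ ≤ ‖x - c‖ + ‖m - c‖ := by
    simpa [norm_sub_rev m c] using norm_sub_le_norm_sub_add_norm_sub x c m
  refine (Real.rpow_le_rpow (norm_nonneg _) h (by linarith)).trans ?_
  exact_mod_cast NNReal.rpow_add_le_mul_rpow_add_rpow ‖x - c‖₊ ‖m - c‖₊ hp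

/-- If `0 < b ≤ w ≤ C`, the distance from the `w`-weighted mean of a probability measure to a point
is controlled by the `p`-th moment about that point. -/
theorem norm_weighted_mean_sub_rpow_le {E : Type*} [NormedAddCommGroup E] [NormedSpace ℝ E]
    [CompleteSpace E] [MeasurableSpace E] {ρ : Measure E} [IsProbabilityMeasure ρ] {w : E → ℝ}
    {b C p : ℝ} (hp : 1 ≤ p) (hw : Measurable w) (hb : 0 < b) (hbw : ∀ x, b ≤ w x)
    (hwC : ∀ x, w x ≤ C) (c : E) (hx : Integrable (fun x => x) ρ)
    (hxp : Integrable (fun x => ‖x - c‖ ^ p) ρ) :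
    ‖(∫ x, w x ∂ρ)⁻¹ • (∫ x, w x • x ∂ρ) - c‖ ^ p ≤ C / b * ∫ x, ‖x - c‖ ^ p ∂ρ := by
  have hw0 : ∀ x, 0 ≤ w x := fun x => hb.le.trans (hbw x)
  have hwb : ∀ᵐ x ∂ρ, ‖w x‖ ≤ C := .of_forall fun x => by
    rw [Real.norm_of_nonneg (hw0 x)]; exact hwC x
  have hwm : AEStronglyMeasurable w ρ := hw.aestronglyMeasurable
  have hwi : Integrable w ρ := Integrable.of_bound hwm C hwb
  have hbZ : b ≤ ∫ x, w x ∂ρ := by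
    simpa using integral_mono (integrable_const b) hwi hbw
  have hZ : 0 < ∫ x, w x ∂ρ := hb.trans_le hbZ
  have hxc : Integrable (fun x => x - c) ρ := hx.sub (integrable_const c)
  have hwx : Integrable (fun x => w x • x) ρ := hx.bdd_smul C hwm hwb
  have hwxc : Integrable (fun x => w x * ‖x - c‖) ρ := hxc.norm.bdd_smul C hwm hwb
  have hwxp : Integrable (fun x => w x * ‖x - c‖ ^ p) ρ := hxp.bdd_smul C hwm hwb
  have hmean : (∫ x, w x ∂ρ)⁻¹ • (∫ x, w x • x ∂ρ) - c
      = (∫ x, w x ∂ρ)⁻¹ • ∫ x, w x • (x - c) ∂ρ := by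
    simp_rw [smul_sub]
    rw [integral_sub hwx (hwi.smul_const c), integral_smul_const, smul_sub, inv_smul_smul₀ hZ.ne']
  have hnorm : ‖(∫ x, w x ∂ρ)⁻¹ • ∫ x, w x • (x - c) ∂ρ‖
      ≤ (∫ x, w x ∂ρ)⁻¹ * ∫ x, w x * ‖x - c‖ ∂ρ := by
    rw [norm_smul, Real.norm_of_nonneg (inv_nonneg.2 hZ.le)]
    refine mul_le_mul_of_nonneg_left ?_ (inv_nonneg.2 hZ.le)
    refine (norm_integral_le_integral_norm _).trans (le_of_eq ?_)
    simp_rw [norm_smul, Real.norm_of_nonneg (hw0 _)]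
  have hC : ∫ x, w x * ‖x - c‖ ^ p ∂ρ ≤ C * ∫ x, ‖x - c‖ ^ p ∂ρ := by
    rw [← integral_const_mul]
    exact integral_mono hwxp (hxp.const_mul C) fun x =>
      mul_le_mul_of_nonneg_right (hwC x) (by positivity)
  rw [hmean]
  calc _ ≤ ((∫ x, w x ∂ρ)⁻¹ * ∫ x, w x * ‖x - c‖ ∂ρ) ^ p :=
        Real.rpow_le_rpow (norm_nonneg _) hnorm (by linarith)
    _ ≤ (∫ x, w x ∂ρ)⁻¹ * ∫ x, w x * ‖x - c‖ ^ p ∂ρ :=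
        rpow_weighted_integral_le hp hw0 (fun x => norm_nonneg _) hwi hwxc hwxp hZ
    _ ≤ b⁻¹ * (C * ∫ x, ‖x - c‖ ^ p ∂ρ) :=
        mul_le_mul (inv_anti₀ hb hbZ) hC
          (integral_nonneg fun x => mul_nonneg (hw0 x) (by positivity)) (by positivity)
    _ = C / b * ∫ x, ‖x - c‖ ^ p ∂ρ := by ring

/-- `∫ |x − m_f^h[ρ]|^p ρ(dx) ≤ 2^{p−1}(1 + Λ_α) ∫ |x − M(ρ)|^p ρ(dx)`. -/
theorem statement17 {d : ℕ} (α hα : ℝ) (hα0 : 0 < α) (hh0 : 0 < hα)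
    (f : EuclideanSpace ℝ (Fin d) → ℝ) (hf : Measurable f)
    (fbar : ℝ) (hfbar : IsGLB (Set.range f) fbar)
    (p : ℝ) (hp : 1 ≤ p)
    (ρ : Measure (EuclideanSpace ℝ (Fin d))) [IsProbabilityMeasure ρ]
    (hmom : Integrable (fun x => ‖x‖ ^ p) ρ) :
    ∫ x, ‖x - wMean α hα f ρ‖ ^ p ∂ρ ≤
      (2 : ℝ) ^ (p - 1) * (1 + Lam α hα fbar) * ∫ x, ‖x - meanMeas ρ‖ ^ p ∂ρ := by
  have hp0 : 0 < p := by linarith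
  have hLp : MemLp (fun x : EuclideanSpace ℝ (Fin d) => x) (ENNReal.ofReal p) ρ := by
    refine (integrable_norm_rpow_iff (f := fun x : EuclideanSpace ℝ (Fin d) => x)
      measurable_id.aestronglyMeasurable (by simpa using hp0) ENNReal.ofReal_ne_top).1 ?_
    rwa [ENNReal.toReal_ofReal hp0.le]
  have hx : Integrable (fun x : EuclideanSpace ℝ (Fin d) => x) ρ :=
    hLp.integrable (by simpa using hp)
  have hsub : ∀ c : EuclideanSpace ℝ (Fin d), Integrable (fun x => ‖x - c‖ ^ p) ρ := fun c => by
    simpa [ENNReal.toReal_ofReal hp0.le] using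
      (hLp.sub (memLp_const c)).integrable_norm_rpow (by simpa using hp0) ENNReal.ofReal_ne_top
  have hψm : Measurable (psiWeight α hα f) := by
    unfold psiWeight
    fun_prop
  have hψ_lower : ∀ x, hα ≤ psiWeight α hα f x := fun x => by
    simpa [psiWeight] using (Real.exp_pos _).le
  have hψ_upper : ∀ x, psiWeight α hα f x ≤ Real.exp (-α * fbar) + hα := fun x => by
    have hfx : fbar ≤ f x := hfbar.1 ⟨x, rfl⟩
    have : -α * f x ≤ -α * fbar := by nlinarith
    unfold psiWeight
    gcongr
  have hmean : ‖wMean α hα f ρ - meanMeas ρ‖ ^ p ≤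
      Lam α hα fbar * ∫ x, ‖x - meanMeas ρ‖ ^ p ∂ρ :=
    norm_weighted_mean_sub_rpow_le hp hψm hh0 hψ_lower hψ_upper _ hx (hsub _)
  calc ∫ x, ‖x - wMean α hα f ρ‖ ^ p ∂ρ
      ≤ ∫ x, 2 ^ (p - 1) *
          (‖x - meanMeas ρ‖ ^ p + ‖wMean α hα f ρ - meanMeas ρ‖ ^ p) ∂ρ :=
        integral_mono (hsub _) (((hsub _).add (integrable_const _)).const_mul _)
          fun x => norm_sub_rpow_le hp _ _ _
    _ = 2 ^ (p - 1) * (∫ x, ‖x - meanMeas ρ‖ ^ p ∂ρ + ‖wMean α hα f ρ - meanMeas ρ‖ ^ p) := by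
        rw [integral_const_mul, integral_add (hsub _) (integrable_const _)]
        simp
    _ ≤ 2 ^ (p - 1) * (∫ x, ‖x - meanMeas ρ‖ ^ p ∂ρ +
          Lam α hα fbar * ∫ x, ‖x - meanMeas ρ‖ ^ p ∂ρ) := by gcongr
    _ = _ := by ring

end
end
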